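/- arXiv:2108.05757 — 5 statements merged into one kernel-verified Lean document; each statement's English description precedes it below -/
import Mathlib

section
/- There exists a constant C > 0, depending only on the dimension 3, with the following property: for every u ∈ L¹(ℝ³; Sym(3)) with div u = 0 in the sense of distributions and every λ > 0 there exists u_λ ∈ L¹(ℝ³; Sym(3)) satisfying (1) the L^∞-bound ‖u_λ‖_{L^∞(ℝ³)} ≤ C λ; (2) the strong stability estimate ‖u − u_λ‖_{L¹(ℝ³)} ≤ C ∫_{{|u| > λ}} |u| dx; (3) the small-change estimate ℒ³({x : u(x) ≠ u_λ(x)}) ≤ C λ⁻¹ ∫_{{|u| > λ}} |u| dx; and (4) div u_λ = 0 in the sense of distributions. -/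
/-!
Divergence-free `L^∞`-truncation of symmetric-matrix valued `L¹` fields on `ℝ³`
(Theorem 1.2 / "Main truncation theorem").
-/

noncomputable section
open MeasureTheory
open scoped ENNReal

/-- Euclidean `ℝ³`. -/
abbrev R3 : Type := EuclideanSpace ℝ (Fin 3)

/-- 3×3 real matrices with the Frobenius norm. -/
abbrev M33 : Type := EuclideanSpace ℝ (Fin 3 × Fin 3)

/-- A 3×3 matrix is symmetric. -/
def IsSym3 (A : M33) : Prop := ∀ i j : Fin 3, A (i, j) = A (j, i)

/-- `div u = 0` in `𝒟'(ℝ³; ℝ³)`, row-wise: for every row `α` and every test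
function `ψ ∈ C_c^∞(ℝ³)` one has `∫ u_α · ∇ψ dx = 0`. -/
def DistDivFree (u : R3 → M33) : Prop :=
  ∀ ψ : R3 → ℝ, ContDiff ℝ (⊤ : ℕ∞) ψ → HasCompactSupport ψ → ∀ α : Fin 3,
    (∫ x : R3, ∑ β : Fin 3, u x (α, β) *
      fderiv ℝ ψ x (EuclideanSpace.single β 1)) = 0


open Filter Metric Set Topology Convolution

/-! ### A weak-type estimate for the uncentred maximal function -/

/-- The superlevel set `{M g > lam}` of the uncentred maximal function of `g`: the union of all
balls on which the average of `g` exceeds `lam`. -/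
def badSet (g : R3 → ℝ) (lam : ℝ) : Set R3 :=
  ⋃ p ∈ {p : R3 × ℝ | 0 < p.2 ∧ lam * volume.real (closedBall p.1 p.2) <
    ∫ x in closedBall p.1 p.2, g x}, ball p.1 p.2

lemma isOpen_badSet (g : R3 → ℝ) (lam : ℝ) : IsOpen (badSet g lam) :=
  isOpen_biUnion fun _ _ => isOpen_ball

lemma setIntegral_closedBall_le_of_notMem_badSet {g : R3 → ℝ} {lam : ℝ} {p y : R3} {r : ℝ}
    (hp : p ∉ badSet g lam) (hpy : p ∈ ball y r) :
    ∫ x in closedBall y r, g x ≤ lam * volume.real (closedBall y r) := by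
  by_contra! h
  exact hp (mem_biUnion (x := (y, r)) ⟨pos_of_mem_ball hpy, h⟩ hpy)

lemma volume_real_closedBall (x : R3) {r : ℝ} (hr : 0 ≤ r) :
    volume.real (closedBall x r) = r ^ 3 * volume.real (ball (0 : R3) 1) := by
  rw [Measure.real, Measure.addHaar_closedBall _ _ hr, ENNReal.toReal_mul,
    ENNReal.toReal_ofReal (by positivity), finrank_euclideanSpace_fin, Measure.real]

lemma volume_badSet_le {g : R3 → ℝ} {lam : ℝ} (hg : Integrable g) (hg0 : ∀ x, 0 ≤ g x)
    (hlam : 0 < lam) :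
    volume (badSet g lam) ≤ ENNReal.ofReal (64 * lam⁻¹ * ∫ x, g x) := by
  set t : Set (R3 × ℝ) := {p : R3 × ℝ | 0 < p.2 ∧ lam * volume.real (closedBall p.1 p.2) <
    ∫ x in closedBall p.1 p.2, g x} with ht
  set c := volume.real (ball (0 : R3) 1) with hc
  have hc0 : 0 < c := ENNReal.toReal_pos (measure_ball_pos _ _ one_pos).ne' measure_ball_lt_top.ne
  have hR : ∀ p ∈ t, p.2 ≤ max 1 ((∫ x, g x) / (lam * c)) := by
    rintro ⟨y, r⟩ ⟨hr, h⟩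
    dsimp only at hr h ⊢
    rcases le_total r 1 with h1 | h1
    · exact le_max_of_le_left h1
    refine le_max_of_le_right ?_
    rw [le_div_iff₀ (by positivity)]
    rw [volume_real_closedBall _ hr.le] at h
    have h2 : ∫ x in closedBall y r, g x ≤ ∫ x, g x :=
      setIntegral_le_integral hg (Eventually.of_forall hg0)
    have h3 : r ≤ r ^ 3 := le_self_pow₀ h1 (by norm_num)
    have h4 : r * (lam * c) ≤ r ^ 3 * (lam * c) := by gcongr
    linarith
  obtain ⟨s, hst, hs, hcov⟩ := Vitali.exists_disjoint_subfamily_covering_enlargement_closedBall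
    t Prod.fst Prod.snd _ hR 4 (by norm_num)
  have hscount : s.Countable := hs.countable_of_nonempty_interior fun p hp =>
    ⟨p.1, ball_subset_interior_closedBall (mem_ball_self (hst hp).1)⟩
  have hsub : badSet g lam ⊆ ⋃ p ∈ s, closedBall p.1 (4 * p.2) := by
    refine iUnion₂_subset fun p hp => ?_
    obtain ⟨q, hq, hpq⟩ := hcov p hp
    exact ball_subset_closedBall.trans (hpq.trans (subset_biUnion_of_mem (u := fun q : R3 × ℝ =>
      closedBall q.1 (4 * q.2)) hq))
  have hball : ∀ p ∈ s, volume (closedBall p.1 (4 * p.2)) ≤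
      ENNReal.ofReal (64 * lam⁻¹) * ∫⁻ x in closedBall p.1 p.2, ENNReal.ofReal (g x) := by
    intro p hp
    obtain ⟨hp0, hp1⟩ := hst hp
    rw [← ofReal_integral_eq_lintegral_ofReal hg.integrableOn (Eventually.of_forall hg0),
      ← ENNReal.ofReal_mul (by positivity),
      ← ENNReal.ofReal_toReal (measure_closedBall_lt_top (x := p.1) (r := 4 * p.2)).ne]
    refine ENNReal.ofReal_le_ofReal ?_
    change volume.real _ ≤ _
    rw [volume_real_closedBall _ (by positivity)]
    rw [volume_real_closedBall _ hp0.le, ← hc] at hp1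
    calc (4 * p.2) ^ 3 * c = 64 * lam⁻¹ * (lam * (p.2 ^ 3 * c)) := by
          field_simp; ring
      _ ≤ _ := by gcongr
  calc volume (badSet g lam) ≤ volume (⋃ p ∈ s, closedBall p.1 (4 * p.2)) := measure_mono hsub
    _ ≤ ∑' p : s, volume (closedBall p.1.1 (4 * p.1.2)) := measure_biUnion_le _ hscount _
    _ ≤ ∑' p : s, ENNReal.ofReal (64 * lam⁻¹) *
          ∫⁻ x in closedBall p.1.1 p.1.2, ENNReal.ofReal (g x) :=
        ENNReal.tsum_le_tsum fun p => hball p p.2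
    _ = ENNReal.ofReal (64 * lam⁻¹) *
          ∫⁻ x in ⋃ p ∈ s, closedBall p.1 p.2, ENNReal.ofReal (g x) := by
        rw [ENNReal.tsum_mul_left, lintegral_biUnion hscount
          (fun p _ => isClosed_closedBall.measurableSet) hs]
    _ ≤ ENNReal.ofReal (64 * lam⁻¹) * ∫⁻ x, ENNReal.ofReal (g x) := by
        gcongr; exact Measure.restrict_le_self
    _ = ENNReal.ofReal (64 * lam⁻¹ * ∫ x, g x) := by
        rw [← ofReal_integral_eq_lintegral_ofReal hg (Eventually.of_forall hg0),
          ← ENNReal.ofReal_mul (by positivity)]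

lemma ae_le_of_notMem_badSet {g : R3 → ℝ} (lam : ℝ) (hg : Integrable g) :
    ∀ᵐ x, x ∉ badSet g lam → g x ≤ lam := by
  filter_upwards [IsUnifLocDoublingMeasure.ae_tendsto_average volume hg.locallyIntegrable 1]
    with x hx hxb
  have hlim := hx (ι := ℝ) (l := 𝓝[>] 0) (fun _ => x) id tendsto_id (by
    filter_upwards [self_mem_nhdsWithin] with r hr
    exact mem_closedBall_self (by simpa using le_of_lt hr))
  refine le_of_tendsto hlim ?_
  filter_upwards [self_mem_nhdsWithin] with r (hr : 0 < r)
  have hpos : 0 < volume.real (closedBall x r) :=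
    ENNReal.toReal_pos (measure_closedBall_pos _ _ hr).ne' measure_closedBall_lt_top.ne
  rw [id, setAverage_eq, smul_eq_mul, inv_mul_le_iff₀ hpos, mul_comm]
  exact setIntegral_closedBall_le_of_notMem_badSet hxb (mem_ball_self hr)

/-! ### Lipschitz test functions -/

/-- A function tested to zero against the gradients of all smooth compactly supported functions
is also tested to zero against the gradients of Lipschitz compactly supported functions. -/
lemma integral_sum_mul_fderiv_eq_zero_of_lipschitz {f : Fin 3 → R3 → ℝ}
    (hf : ∀ β, Integrable (f β))
    (h : ∀ ψ : R3 → ℝ, ContDiff ℝ (⊤ : ℕ∞) ψ → HasCompactSupport ψ →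
      ∫ x, ∑ β, f β x * fderiv ℝ ψ x (EuclideanSpace.single β 1) = 0)
    {Φ : R3 → ℝ} {K : NNReal} (hΦ : LipschitzWith K Φ) (hΦc : HasCompactSupport Φ) :
    ∫ x, ∑ β, f β x * fderiv ℝ Φ x (EuclideanSpace.single β 1) = 0 := by
  let φ : ℕ → ContDiffBump (0 : R3) := fun n =>
    ⟨1 / ((n : ℝ) + 1), 2 * (1 / ((n : ℝ) + 1)), by positivity, by
      have : 0 < 1 / ((n : ℝ) + 1) := by positivity
      linarith⟩
  have hφ : Tendsto (fun n => (φ n).rOut) atTop (𝓝 0) := by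
    have := (tendsto_one_div_add_atTop_nhds_zero_nat (𝕜 := ℝ)).const_mul 2
    rwa [mul_zero] at this
  have hΦi : LocallyIntegrable Φ := hΦ.continuous.locallyIntegrable
  let ρ : ℕ → R3 → ℝ := fun n => (φ n).normed volume
  have hρs : ∀ n, ContDiff ℝ (⊤ : ℕ∞) (ρ n) := fun n => (φ n).contDiff_normed
  have hρc : ∀ n, HasCompactSupport (ρ n) := fun n => (φ n).hasCompactSupport_normed
  let Ψ : ℕ → R3 → ℝ := fun n => ρ n ⋆[ContinuousLinearMap.lsmul ℝ ℝ, volume] Φ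
  have hΨs : ∀ n, ContDiff ℝ (⊤ : ℕ∞) (Ψ n) := fun n =>
    (hρc n).contDiff_convolution_left _ (hρs n) hΦi
  have hΨc : ∀ n, HasCompactSupport (Ψ n) := fun n => (hρc n).convolution _ hΦc
  have hbound : ∀ x v, ‖fderiv ℝ Φ x v‖ ≤ K * ‖v‖ := fun x v =>
    (fderiv ℝ Φ x).le_of_opNorm_le (norm_fderiv_le_of_lipschitz ℝ hΦ) v
  have hloc : ∀ v, LocallyIntegrable (fun x => fderiv ℝ Φ x v) := fun v =>
    (locallyIntegrable_const (K * ‖v‖ : ℝ)).mono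
      (measurable_fderiv_apply_const ℝ Φ v).aestronglyMeasurable
      (Eventually.of_forall fun x => (hbound x v).trans (le_abs_self _))
  have hderiv : ∀ n x v, fderiv ℝ (Ψ n) x v = ∫ t, ρ n t * fderiv ℝ Φ (x - t) v := by
    intro n x v
    have hdiff : ∀ᵐ t, DifferentiableAt ℝ Φ (x - t) :=
      (Measure.measurePreserving_sub_left volume x).quasiMeasurePreserving.ae hΦ.ae_differentiableAt
    have hρi : Integrable (ρ n) := (hρs n).continuous.integrable_of_hasCompactSupport (hρc n)
    have key := hasFDerivAt_integral_of_dominated_loc_of_lip (𝕜 := ℝ) (μ := (volume : Measure R3))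
      (F := fun x t => ρ n t * Φ (x - t)) (F' := fun t => ρ n t • fderiv ℝ Φ (x - t))
      (x₀ := x) (s := univ) (bound := fun t => ρ n t * K) univ_mem
      (Eventually.of_forall fun y => ((hρs n).continuous.mul
        (hΦ.continuous.comp (continuous_const.sub continuous_id))).aestronglyMeasurable)
      (((hρs n).continuous.mul (hΦ.continuous.comp (continuous_const.sub
        continuous_id))).integrable_of_hasCompactSupport (hρc n).mul_right)
      (((hρs n).continuous.measurable.smul ((measurable_fderiv ℝ Φ).comp
        (measurable_const.sub measurable_id))).aestronglyMeasurable)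
      (Eventually.of_forall fun t => LipschitzOnWith.of_dist_le_mul fun y _ z _ => by
        have h1 := hΦ.dist_le_mul (y - t) (z - t)
        rw [dist_sub_right, Real.dist_eq] at h1
        rw [Real.dist_eq, ← mul_sub, abs_mul, Real.coe_nnabs, abs_mul, NNReal.abs_eq, mul_assoc]
        gcongr)
      (hρi.mul_const _)
      (hdiff.mono fun t ht => by
        have := (ht.hasFDerivAt.comp x ((hasFDerivAt_id x).sub_const t)).const_mul (ρ n t)
        simpa using this)
    have h2 : fderiv ℝ (Ψ n) x = ∫ t, ρ n t • fderiv ℝ Φ (x - t) := key.2.fderiv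
    rw [h2, ContinuousLinearMap.integral_apply key.1]
    rfl
  have hΨbound : ∀ n x v, ‖fderiv ℝ (Ψ n) x v‖ ≤ K * ‖v‖ := by
    intro n x v
    have hρi : Integrable (ρ n) := (hρs n).continuous.integrable_of_hasCompactSupport (hρc n)
    have h1 : ∫ t, ρ n t = 1 := (φ n).integral_normed
    rw [hderiv]
    refine (norm_integral_le_of_norm_le (hρi.mul_const (K * ‖v‖))
      (Eventually.of_forall fun t => ?_)).trans_eq (by rw [integral_mul_const, h1, one_mul])
    rw [norm_mul, Real.norm_of_nonneg ((φ n).nonneg_normed t)]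
    exact mul_le_mul_of_nonneg_left (hbound _ _) ((φ n).nonneg_normed t)
  have hlim : ∀ᵐ x, ∀ β : Fin 3, Tendsto
      (fun n => fderiv ℝ (Ψ n) x (EuclideanSpace.single β 1)) atTop
      (𝓝 (fderiv ℝ Φ x (EuclideanSpace.single β 1))) := by
    refine ae_all_iff.2 fun β => ?_
    filter_upwards [ContDiffBump.ae_convolution_tendsto_right_of_locallyIntegrable
      (φ := φ) (K := 2) hφ (Eventually.of_forall fun n => le_rfl)
      (hloc (EuclideanSpace.single β 1))] with x hx
    simpa only [hderiv] using! hx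
  have htend : Tendsto (fun n => ∫ x, ∑ β, f β x *
      fderiv ℝ (Ψ n) x (EuclideanSpace.single β 1)) atTop
      (𝓝 (∫ x, ∑ β, f β x * fderiv ℝ Φ x (EuclideanSpace.single β 1))) := by
    refine tendsto_integral_of_dominated_convergence (fun x => ∑ β, ‖f β x‖ * K) ?_ ?_ ?_ ?_
    · intro n
      exact Finset.aestronglyMeasurable_fun_sum _ fun β _ => (hf β).1.mul
        (measurable_fderiv_apply_const ℝ (Ψ n) _).aestronglyMeasurable
    · exact integrable_finsetSum _ fun β _ => (hf β).norm.mul_const _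
    · refine fun n => Eventually.of_forall fun x => (norm_sum_le _ _).trans ?_
      refine Finset.sum_le_sum fun β _ => ?_
      rw [norm_mul]
      gcongr
      simpa using hΨbound n x (EuclideanSpace.single β 1)
    · filter_upwards [hlim] with x hx
      exact tendsto_finsetSum _ fun β _ => (hx β).const_mul _
  refine tendsto_nhds_unique htend ?_
  simp only [h _ (hΨs _) (hΨc _)]
  exact tendsto_const_nhds

/-! ### A radial mollifier -/

/-- A smooth radial function supported in the closed unit ball, not normalised. -/
def radialProfile (y : R3) : ℝ := Real.smoothTransition (1 - ‖y‖ ^ 2)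

/-- A smooth radial probability density supported in the closed unit ball. -/
def radialBump (y : R3) : ℝ := (∫ z, radialProfile z)⁻¹ * radialProfile y

lemma contDiff_radialProfile : ContDiff ℝ (⊤ : ℕ∞) radialProfile :=
  Real.smoothTransition.contDiff.comp (contDiff_const.sub (contDiff_norm_sq ℝ))

lemma radialProfile_eq_zero {y : R3} (hy : 1 ≤ ‖y‖) : radialProfile y = 0 :=
  Real.smoothTransition.zero_of_nonpos (by nlinarith)

lemma hasCompactSupport_radialProfile : HasCompactSupport radialProfile :=
  HasCompactSupport.intro (isCompact_closedBall (0 : R3) 1) fun y hy =>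
    radialProfile_eq_zero (by simpa using (not_le.1 fun h => hy (by simpa using h)).le)

lemma integral_radialProfile_pos : 0 < ∫ y, radialProfile y :=
  contDiff_radialProfile.continuous.integral_pos_of_hasCompactSupport_nonneg_nonzero
    hasCompactSupport_radialProfile (fun _ => Real.smoothTransition.nonneg _) (x := 0)
    (by simp [radialProfile])

lemma contDiff_radialBump : ContDiff ℝ (⊤ : ℕ∞) radialBump :=
  contDiff_const.mul contDiff_radialProfile

lemma continuous_radialBump : Continuous radialBump := contDiff_radialBump.continuous

lemma radialBump_nonneg (y : R3) : 0 ≤ radialBump y :=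
  mul_nonneg (inv_nonneg.2 integral_radialProfile_pos.le) (Real.smoothTransition.nonneg _)

lemma radialBump_le (y : R3) : radialBump y ≤ (∫ z, radialProfile z)⁻¹ :=
  mul_le_of_le_one_right (inv_nonneg.2 integral_radialProfile_pos.le)
    (Real.smoothTransition.le_one _)

lemma radialBump_eq_zero {y : R3} (hy : 1 ≤ ‖y‖) : radialBump y = 0 := by
  rw [radialBump, radialProfile_eq_zero hy, mul_zero]

lemma hasCompactSupport_radialBump : HasCompactSupport radialBump :=
  hasCompactSupport_radialProfile.mul_left

lemma integrable_radialBump_mul {f : R3 → ℝ} (hf : Continuous f) :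
    Integrable fun y => radialBump y * f y :=
  (continuous_radialBump.mul hf).integrable_of_hasCompactSupport
    hasCompactSupport_radialBump.mul_right

lemma integrable_radialBump : Integrable radialBump :=
  continuous_radialBump.integrable_of_hasCompactSupport hasCompactSupport_radialBump

lemma integral_radialBump : ∫ y, radialBump y = 1 := by
  simp only [radialBump, integral_const_mul]
  exact inv_mul_cancel₀ integral_radialProfile_pos.ne'

lemma integral_radialBump_mul_coord (j : Fin 3) : ∫ y : R3, radialBump y * y j = 0 := by
  have h := integral_neg_eq_self (fun y : R3 => radialBump y * y j) volume
  have h2 : ∀ y : R3, radialBump (-y) * (-y) j = -(radialBump y * y j) := fun y => by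
    simp [radialBump, radialProfile]
  simp only [h2, integral_neg] at h
  linarith

lemma fderiv_radialBump (y : R3) : ∃ k : ℝ, ∀ i : Fin 3,
    fderiv ℝ radialBump y (EuclideanSpace.single i 1) = k * y i := by
  have h1 : DifferentiableAt ℝ Real.smoothTransition (1 - ‖y‖ ^ 2) :=
    (Real.smoothTransition.contDiff (n := 1)).differentiable one_ne_zero _
  have h2 : HasFDerivAt (fun y : R3 => 1 - ‖y‖ ^ 2) (-(2 • innerSL ℝ y)) y :=
    ((hasStrictFDerivAt_norm_sq y).hasFDerivAt).const_sub 1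
  have h3 := (h1.hasDerivAt.comp_hasFDerivAt y h2).const_mul (∫ z, radialProfile z)⁻¹
  refine ⟨-((∫ z, radialProfile z)⁻¹ * deriv Real.smoothTransition (1 - ‖y‖ ^ 2) * 2),
    fun i => ?_⟩
  have h4 : fderiv ℝ radialBump y = _ := h3.fderiv
  rw [h4]
  simp [EuclideanSpace.inner_single_right]
  ring

lemma fderiv_radialBump_mul_coord (y : R3) (i j : Fin 3) :
    fderiv ℝ (fun y : R3 => radialBump y * y i) y (EuclideanSpace.single j 1) =
      fderiv ℝ (fun y : R3 => radialBump y * y j) y (EuclideanSpace.single i 1) := by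
  obtain ⟨k, hk⟩ := fderiv_radialBump y
  have hd : DifferentiableAt ℝ radialBump y :=
    contDiff_radialBump.differentiable (by simp) y
  have h : ∀ i j : Fin 3,
      fderiv ℝ (fun y : R3 => radialBump y * y i) y (EuclideanSpace.single j 1) =
        radialBump y * (if i = j then 1 else 0) + y i * (k * y j) := fun i j => by
    have h1 := (hd.hasFDerivAt.mul (EuclideanSpace.proj (𝕜 := ℝ) i).hasFDerivAt (x := y)).fderiv
    have h2 : fderiv ℝ (fun y : R3 => radialBump y * y i) y = _ := h1
    rw [h2]
    simp [hk]
  rw [h, h]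
  simp only [eq_comm (a := i)]
  ring

/-- Radial densities annihilate the infinitesimal rotations `y i ∂_j - y j ∂_i`. -/
lemma integral_radialBump_mul_rotation {w : R3 → ℝ} (hw : ContDiff ℝ (⊤ : ℕ∞) w) (i j : Fin 3) :
    ∫ y : R3, radialBump y * (y i * fderiv ℝ w y (EuclideanSpace.single j 1) -
      y j * fderiv ℝ w y (EuclideanSpace.single i 1)) = 0 := by
  have hc : ∀ i : Fin 3, Continuous fun y : R3 => y i := fun i => by fun_prop
  have hwc : ∀ i : Fin 3, Continuous fun y : R3 => fderiv ℝ w y (EuclideanSpace.single i 1) :=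
    fun i => (hw.continuous_fderiv (by simp)).clm_apply continuous_const
  have hb : ∀ i : Fin 3, ContDiff ℝ (⊤ : ℕ∞) fun y : R3 => radialBump y * y i := fun i =>
    contDiff_radialBump.mul (by fun_prop)
  have hbs : ∀ i : Fin 3, HasCompactSupport fun y : R3 => radialBump y * y i := fun i =>
    hasCompactSupport_radialBump.mul_right
  have hbc : ∀ i j : Fin 3, Continuous fun y : R3 =>
      fderiv ℝ (fun y : R3 => radialBump y * y i) y (EuclideanSpace.single j 1) := fun i j =>
    ((hb i).continuous_fderiv (by simp)).clm_apply continuous_const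
  have hI : ∀ i j : Fin 3,
      Integrable fun y : R3 => radialBump y * y i * fderiv ℝ w y (EuclideanSpace.single j 1) :=
    fun i j => ((hb i).continuous.mul (hwc j)).integrable_of_hasCompactSupport (hbs i).mul_right
  have hparts : ∀ i j : Fin 3,
      ∫ y : R3, radialBump y * y i * fderiv ℝ w y (EuclideanSpace.single j 1) =
        -∫ y : R3, fderiv ℝ (fun y : R3 => radialBump y * y i) y (EuclideanSpace.single j 1) *
          w y := fun i j =>
    integral_mul_fderiv_eq_neg_fderiv_mul_of_integrable
      (((hbc i j).mul hw.continuous).integrable_of_hasCompactSupport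
        ((hbs i).fderiv_apply ℝ _).mul_right)
      (hI i j)
      (((hb i).continuous.mul hw.continuous).integrable_of_hasCompactSupport (hbs i).mul_right)
      (fun y _ => (hb i).differentiable (by simp) y)
      (fun y _ => hw.differentiable (by simp) y)
  simp only [mul_sub, ← mul_assoc]
  rw [integral_sub (hI i j) (hI j i), hparts, hparts]
  simp only [fderiv_radialBump_mul_coord _ i j, sub_self]

/-! ### Smoothing at a variable scale -/

lemma clm_apply_eq_sum (ℓ : R3 →L[ℝ] ℝ) (y : R3) :
    ℓ y = ∑ j, y j * ℓ (EuclideanSpace.single j 1) := by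
  conv_lhs => rw [← (EuclideanSpace.basisFun (Fin 3) ℝ).sum_repr y]
  simp

/-- Averaging of `ψ` at the variable scale `ε`. -/
def variableSmoothing (ε ψ : R3 → ℝ) (x : R3) : ℝ := ∫ y, radialBump y * ψ (x + ε x • y)

section VariableSmoothing

variable {ε ψ : R3 → ℝ} {K L : NNReal}

lemma dist_radialBump_mul_le (hε : LipschitzWith L ε) (hψ : LipschitzWith K ψ) (x x' y : R3) :
    dist (radialBump y * ψ (x + ε x • y)) (radialBump y * ψ (x' + ε x' • y)) ≤
      radialBump y * (K * (1 + L)) * dist x x' := by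
  rw [Real.dist_eq, ← mul_sub, abs_mul, abs_of_nonneg (radialBump_nonneg y)]
  rcases le_total 1 ‖y‖ with hy | hy
  · simp [radialBump_eq_zero hy]
  have h1 : dist (x + ε x • y) (x' + ε x' • y) ≤ (1 + L) * dist x x' := by
    calc dist (x + ε x • y) (x' + ε x' • y) ≤ dist x x' + dist (ε x • y) (ε x' • y) :=
          dist_add_add_le _ _ _ _
      _ = dist x x' + dist (ε x) (ε x') * ‖y‖ := by
          rw [dist_eq_norm (ε x • y), ← sub_smul, norm_smul, dist_eq_norm (ε x)]
      _ ≤ dist x x' + (L * dist x x') * 1 := by gcongr; exact hε.dist_le_mul x x'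
      _ = _ := by ring
  have h2 := hψ.dist_le_mul (x + ε x • y) (x' + ε x' • y)
  rw [Real.dist_eq] at h2
  have h3 : (K : ℝ) * dist (x + ε x • y) (x' + ε x' • y) ≤ K * ((1 + L) * dist x x') := by gcongr
  calc _ ≤ radialBump y * (K * ((1 + L) * dist x x')) :=
        mul_le_mul_of_nonneg_left (h2.trans h3) (radialBump_nonneg y)
    _ = _ := by ring

lemma lipschitzWith_variableSmoothing (hε : LipschitzWith L ε) (hψ : LipschitzWith K ψ) :
    LipschitzWith (K * (1 + L)) (variableSmoothing ε ψ) := by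
  refine LipschitzWith.of_dist_le_mul fun x x' => ?_
  have hi : ∀ x, Integrable fun y => radialBump y * ψ (x + ε x • y) := fun x =>
    integrable_radialBump_mul (hψ.continuous.comp (by fun_prop))
  rw [variableSmoothing, variableSmoothing, dist_eq_norm, ← integral_sub (hi x) (hi x')]
  refine (norm_integral_le_of_norm_le
    ((integrable_radialBump.mul_const (K * (1 + L) : ℝ)).mul_const (dist x x'))
    (Eventually.of_forall fun y => ?_)).trans_eq ?_
  · rw [← dist_eq_norm]
    exact dist_radialBump_mul_le hε hψ x x' y
  · rw [integral_mul_const, integral_mul_const, integral_radialBump]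
    simp

lemma hasCompactSupport_variableSmoothing (hε : LipschitzWith L ε) (hL : L < 1)
    (hψ : HasCompactSupport ψ) : HasCompactSupport (variableSmoothing ε ψ) := by
  obtain ⟨R, hR⟩ := hψ.isCompact.isBounded.subset_closedBall (0 : R3)
  have hL' : 0 < 1 - (L : ℝ) := sub_pos.2 (by exact_mod_cast hL)
  refine HasCompactSupport.intro
    (isCompact_closedBall (0 : R3) ((R + |ε 0|) / (1 - L))) fun x hx => ?_
  have hx' : R + |ε 0| < ‖x‖ * (1 - L) := by
    rw [← div_lt_iff₀ hL']
    simpa using hx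
  refine integral_eq_zero_of_ae (Eventually.of_forall fun y => ?_)
  rcases le_total 1 ‖y‖ with hy | hy
  · simp [radialBump_eq_zero hy]
  have h0 : ψ (x + ε x • y) = 0 := by
    refine image_eq_zero_of_notMem_tsupport fun hmem => ?_
    have h1 : ‖x + ε x • y‖ ≤ R := by simpa using hR hmem
    have h2 : ‖x‖ ≤ ‖x + ε x • y‖ + ‖ε x • y‖ := by
      simpa using norm_sub_le (x + ε x • y) (ε x • y)
    have h3 : |ε x - ε 0| ≤ L * ‖x‖ := by simpa [Real.dist_eq] using hε.dist_le_mul x 0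
    have h4 : |ε x| ≤ |ε x - ε 0| + |ε 0| := by simpa using abs_add_le (ε x - ε 0) (ε 0)
    have h5 : ‖ε x • y‖ ≤ |ε x| := by
      rw [norm_smul, Real.norm_eq_abs]
      exact mul_le_of_le_one_right (abs_nonneg _) hy
    linarith
  simp [h0]

lemma fderiv_variableSmoothing (hε : LipschitzWith L ε) (hψ : LipschitzWith K ψ)
    (hψs : ContDiff ℝ (⊤ : ℕ∞) ψ) {x : R3} (hx : DifferentiableAt ℝ ε x) (v : R3) :
    fderiv ℝ (variableSmoothing ε ψ) x v = ∫ y, radialBump y *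
      (fderiv ℝ ψ (x + ε x • y) v + fderiv ℝ ε x v * fderiv ℝ ψ (x + ε x • y) y) := by
  have hψd : Continuous (fderiv ℝ ψ) := hψs.continuous_fderiv (by simp)
  have hc : ∀ x, Continuous fun y => radialBump y * ψ (x + ε x • y) := fun x =>
    continuous_radialBump.mul (hψ.continuous.comp (by fun_prop))
  have key := hasFDerivAt_integral_of_dominated_loc_of_lip (𝕜 := ℝ) (μ := (volume : Measure R3))
    (F := fun x y => radialBump y * ψ (x + ε x • y))
    (F' := fun y => radialBump y • (fderiv ℝ ψ (x + ε x • y)).comp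
      (ContinuousLinearMap.id ℝ R3 + (fderiv ℝ ε x).smulRight y))
    (x₀ := x) (s := univ) (bound := fun y => radialBump y * (K * (1 + L))) univ_mem
    (Eventually.of_forall fun x => (hc x).aestronglyMeasurable)
    (integrable_radialBump_mul (hψ.continuous.comp (by fun_prop)))
    (continuous_radialBump.smul ((hψd.comp (by fun_prop)).clm_comp
      (by fun_prop))).aestronglyMeasurable
    (Eventually.of_forall fun y => LipschitzOnWith.of_dist_le_mul fun x _ x' _ => by
      refine (dist_radialBump_mul_le hε hψ x x' y).trans ?_
      gcongr
      exact le_abs_self _)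
    (integrable_radialBump.mul_const _)
    (Eventually.of_forall fun y => by
      have h1 : HasFDerivAt (fun x => x + ε x • y)
          (ContinuousLinearMap.id ℝ R3 + (fderiv ℝ ε x).smulRight y) x :=
        (hasFDerivAt_id x).add (hx.hasFDerivAt.smul_const y)
      exact (((hψs.differentiable (by simp)) _).hasFDerivAt.comp x h1).const_mul _)
  have h2 : fderiv ℝ (variableSmoothing ε ψ) x = _ := key.2.fderiv
  rw [h2, ContinuousLinearMap.integral_apply key.1]
  simp [mul_add]

/-- Smoothing at the variable scale `ε` does not change the gradient at zeros of `ε`. -/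
lemma fderiv_variableSmoothing_of_eq_zero (hε : LipschitzWith L ε) (hψ : LipschitzWith K ψ)
    (hψs : ContDiff ℝ (⊤ : ℕ∞) ψ) {x : R3} (hx : DifferentiableAt ℝ ε x) (h0 : ε x = 0) (v : R3) :
    fderiv ℝ (variableSmoothing ε ψ) x v = fderiv ℝ ψ x v := by
  rw [fderiv_variableSmoothing hε hψ hψs hx]
  simp only [h0, zero_smul, add_zero, mul_add]
  rw [integral_add (integrable_radialBump.mul_const _) (integrable_radialBump_mul (by fun_prop)),
    integral_mul_const, integral_radialBump, one_mul, add_eq_left]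
  have hexp : ∀ y : R3, radialBump y * (fderiv ℝ ε x v * fderiv ℝ ψ x y) =
      ∑ j, radialBump y * (y j * (fderiv ℝ ε x v * fderiv ℝ ψ x (EuclideanSpace.single j 1))) :=
    fun y => by
      rw [clm_apply_eq_sum (fderiv ℝ ψ x) y, Finset.mul_sum, Finset.mul_sum]
      exact Finset.sum_congr rfl fun j _ => by ring
  simp only [hexp]
  rw [integral_finsetSum _ fun j _ => integrable_radialBump_mul (by fun_prop)]
  refine Finset.sum_eq_zero fun j _ => ?_
  rw [← zero_mul (fderiv ℝ ε x v * fderiv ℝ ψ x (EuclideanSpace.single j 1)),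
    ← integral_radialBump_mul_coord j, ← integral_mul_const]
  exact integral_congr_ae (Eventually.of_forall fun y => by ring)

end VariableSmoothing

/-! ### The truncation operator attached to a scale function -/

/-- The symmetric tensor `U + y ⊗ Us + Us ⊗ y - (y · Us) I`. -/
def truncTensor (U : M33) (s : Fin 3 → ℝ) (y : R3) (i j : Fin 3) : ℝ :=
  U (i, j) + y i * ∑ b, U (j, b) * s b + y j * ∑ b, U (i, b) * s b -
    if i = j then ∑ b, y b * ∑ c, U (b, c) * s c else 0

lemma truncTensor_comm {U : M33} (hU : IsSym3 U) (s : Fin 3 → ℝ) (y : R3) (i j : Fin 3) :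
    truncTensor U s y i j = truncTensor U s y j i := by
  simp only [truncTensor, hU i j, eq_comm (a := i)]
  ring

lemma abs_truncTensor_le (U : M33) {s : Fin 3 → ℝ} (hs : ∀ b, |s b| ≤ 1) {y : R3} (hy : ‖y‖ ≤ 1)
    (i j : Fin 3) : |truncTensor U s y i j| ≤ 16 * ‖U‖ := by
  have hU : ∀ p, |U p| ≤ ‖U‖ := fun p => PiLp.norm_apply_le U p
  have hyi : ∀ i, |y i| ≤ 1 := fun i => (PiLp.norm_apply_le y i).trans hy
  have ht : ∀ i, |∑ b, U (i, b) * s b| ≤ 3 * ‖U‖ := fun i => by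
    refine (Finset.abs_sum_le_sum_abs _ _).trans ((Finset.sum_le_card_nsmul _ _ ‖U‖
      fun b _ => ?_).trans_eq (by simp))
    rw [abs_mul]
    exact (mul_le_of_le_one_right (abs_nonneg _) (hs b)).trans (hU _)
  have hyt : ∀ i j, |y i * ∑ b, U (j, b) * s b| ≤ 3 * ‖U‖ := fun i j => by
    rw [abs_mul]
    exact (mul_le_of_le_one_left (abs_nonneg _) (hyi i)).trans (ht j)
  have hd : |if i = j then ∑ b, y b * ∑ c, U (b, c) * s c else 0| ≤ 9 * ‖U‖ := by
    split_ifs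
    · refine (Finset.abs_sum_le_sum_abs _ _).trans ((Finset.sum_le_card_nsmul _ _ (3 * ‖U‖)
        fun b _ => hyt b b).trans_eq ?_)
      simp; ring
    · simp
  have h1 := abs_le.1 (hU (i, j))
  have h2 := abs_le.1 (hyt i j)
  have h3 := abs_le.1 (hyt j i)
  have h4 := abs_le.1 hd
  rw [truncTensor, abs_le]
  constructor <;> linarith

lemma sum_truncTensor_mul (U : M33) (s : Fin 3 → ℝ) (y : R3) (p : R3 →L[ℝ] ℝ) (α : Fin 3) :
    ∑ β, truncTensor U s y α β * p (EuclideanSpace.single β 1) =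
      ∑ β, U (α, β) * (p (EuclideanSpace.single β 1) + s β * p y) +
      ∑ β, (∑ b, U (β, b) * s b) * (y α * p (EuclideanSpace.single β 1) -
        y β * p (EuclideanSpace.single α 1)) := by
  rw [clm_apply_eq_sum p y]
  generalize hq : (fun i => p (EuclideanSpace.single i 1)) = q
  simp only [funext_iff] at hq
  simp only [hq, truncTensor]
  fin_cases α <;> simp [Fin.sum_univ_three] <;> ring

/-- The rescaled radial bump `ε(x)⁻³ η((z - x) / ε(x))`; it vanishes when `ε x = 0`. -/
def scaledBump (ε : R3 → ℝ) (x z : R3) : ℝ :=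
  radialBump ((ε x)⁻¹ • (z - x)) * (ε x)⁻¹ ^ 3

/-- The kernel of the truncation operator. -/
def truncKernel (ε : R3 → ℝ) (u : R3 → M33) (i j : Fin 3) (x z : R3) : ℝ :=
  scaledBump ε x z * truncTensor (u x) (fun b => fderiv ℝ ε x (EuclideanSpace.single b 1))
    ((ε x)⁻¹ • (z - x)) i j

/-- The truncation of `u` with scale function `ε`: it equals `u` where `ε = 0` and a weighted
average of `u` at scale `ε` elsewhere. -/
def truncation (ε : R3 → ℝ) (u : R3 → M33) (z : R3) : M33 :=
  WithLp.toLp 2 fun p => {z | ε z = 0}.indicator (fun z => u z p) z +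
    ∫ x, truncKernel ε u p.1 p.2 x z

lemma isSym3_truncation (ε : R3 → ℝ) {u : R3 → M33} (hu : ∀ x, IsSym3 (u x)) (z : R3) :
    IsSym3 (truncation ε u z) := by
  intro i j
  simp only [truncation, truncKernel, truncTensor_comm (hu _) _ _ i j, indicator, hu z i j]

lemma integral_rescale (F : R3 → ℝ) {e : ℝ} (he : 0 < e) (x : R3) :
    ∫ z, F (e⁻¹ • (z - x)) * e⁻¹ ^ 3 = ∫ y, F y := by
  rw [integral_mul_const, integral_sub_right_eq_self (fun z => F (e⁻¹ • z)) x,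
    Measure.integral_comp_inv_smul, finrank_euclideanSpace_fin, abs_of_pos (by positivity),
    smul_eq_mul]
  field_simp

lemma integrable_rescale {F : R3 → ℝ} (hF : Integrable F) {e : ℝ} (he : 0 < e) (x : R3) :
    Integrable fun z => F (e⁻¹ • (z - x)) * e⁻¹ ^ 3 :=
  ((hF.comp_smul (inv_ne_zero he.ne')).comp_sub_right x).mul_const _

section Truncation

variable {ε : R3 → ℝ} {u : R3 → M33}

lemma scaledBump_nonneg (hε0 : ∀ x, 0 ≤ ε x) (x z : R3) : 0 ≤ scaledBump ε x z :=
  mul_nonneg (radialBump_nonneg _) (pow_nonneg (inv_nonneg.2 (hε0 x)) 3)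

lemma scaledBump_of_eq_zero {x : R3} (hx : ε x = 0) (z : R3) : scaledBump ε x z = 0 := by
  simp [scaledBump, hx]

lemma integrable_scaledBump (hε0 : ∀ x, 0 ≤ ε x) (x : R3) : Integrable (scaledBump ε x) := by
  rcases (hε0 x).eq_or_lt with h | h
  · rw [show scaledBump ε x = 0 from funext (scaledBump_of_eq_zero h.symm)]
    exact integrable_zero _ _ _
  · exact integrable_rescale integrable_radialBump h x

lemma integral_scaledBump_le (hε0 : ∀ x, 0 ≤ ε x) (x : R3) : ∫ z, scaledBump ε x z ≤ 1 := by
  rcases (hε0 x).eq_or_lt with h | h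
  · simp [scaledBump_of_eq_zero h.symm]
  · exact ((integral_rescale radialBump h x).trans integral_radialBump).le

lemma dist_lt_of_scaledBump_ne_zero (hε0 : ∀ x, 0 ≤ ε x) {x z : R3} (h : scaledBump ε x z ≠ 0) :
    dist z x < ε x := by
  have hx : 0 < ε x := (hε0 x).lt_of_ne' fun h0 => h (scaledBump_of_eq_zero h0 z)
  by_contra! hd
  refine h ?_
  rw [scaledBump, radialBump_eq_zero, zero_mul]
  rwa [norm_smul, norm_inv, Real.norm_of_nonneg hx.le, ← dist_eq_norm, inv_mul_eq_div,
    one_le_div hx]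

lemma abs_fderiv_single_le (hε : LipschitzWith (1 / 2) ε) (x : R3) (b : Fin 3) :
    |fderiv ℝ ε x (EuclideanSpace.single b 1)| ≤ 1 := by
  have := (fderiv ℝ ε x).le_of_opNorm_le (norm_fderiv_le_of_lipschitz ℝ hε)
    (EuclideanSpace.single b 1)
  rw [PiLp.norm_single, Real.norm_eq_abs] at this
  norm_num at this
  linarith

lemma abs_truncKernel_le (hε : LipschitzWith (1 / 2) ε) (hε0 : ∀ x, 0 ≤ ε x) (i j : Fin 3)
    (x z : R3) : |truncKernel ε u i j x z| ≤ 16 * ‖u x‖ * scaledBump ε x z := by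
  rw [truncKernel, abs_mul, abs_of_nonneg (scaledBump_nonneg hε0 x z), mul_comm]
  by_cases h : scaledBump ε x z = 0
  · simp [h]
  refine mul_le_mul_of_nonneg_right ?_ (scaledBump_nonneg hε0 x z)
  refine abs_truncTensor_le _ (abs_fderiv_single_le hε x) ?_ i j
  by_contra! h1
  exact h (by rw [scaledBump, radialBump_eq_zero h1.le, zero_mul])

lemma measurable_scaledBump (hε : LipschitzWith (1 / 2) ε) :
    Measurable fun q : R3 × R3 => scaledBump ε q.1 q.2 := by
  have h1 : Measurable fun q : R3 × R3 => (ε q.1)⁻¹ :=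
    (hε.continuous.measurable.comp measurable_fst).inv
  exact (continuous_radialBump.measurable.comp
    (h1.smul (measurable_snd.sub measurable_fst))).mul (h1.pow_const 3)

lemma aestronglyMeasurable_apply (hu : AEStronglyMeasurable u) (p : Fin 3 × Fin 3) :
    AEStronglyMeasurable (fun x => u x p) :=
  (EuclideanSpace.proj (𝕜 := ℝ) p).continuous.comp_aestronglyMeasurable hu

lemma aestronglyMeasurable_truncKernel (hε : LipschitzWith (1 / 2) ε)
    (hu : AEStronglyMeasurable u) (i j : Fin 3) :
    AEStronglyMeasurable (fun q : R3 × R3 => truncKernel ε u i j q.1 q.2)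
      (volume.prod volume) := by
  have h1 : Measurable fun q : R3 × R3 => (ε q.1)⁻¹ :=
    (hε.continuous.measurable.comp measurable_fst).inv
  have hU : ∀ p, AEStronglyMeasurable (fun q : R3 × R3 => u q.1 p) (volume.prod volume) :=
    fun p => (aestronglyMeasurable_apply hu p).comp_fst
  have hs : ∀ b, AEStronglyMeasurable
      (fun q : R3 × R3 => fderiv ℝ ε q.1 (EuclideanSpace.single b 1)) (volume.prod volume) :=
    fun b => ((measurable_fderiv_apply_const ℝ ε _).comp measurable_fst).aestronglyMeasurable
  have hy : ∀ b, AEStronglyMeasurable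
      (fun q : R3 × R3 => ((ε q.1)⁻¹ • (q.2 - q.1)) b) (volume.prod volume) := fun b =>
    ((EuclideanSpace.proj (𝕜 := ℝ) b).continuous.measurable.comp
      (h1.smul (measurable_snd.sub measurable_fst))).aestronglyMeasurable
  have ht : ∀ i, AEStronglyMeasurable (fun q : R3 × R3 => ∑ b, u q.1 (i, b) *
      fderiv ℝ ε q.1 (EuclideanSpace.single b 1)) (volume.prod volume) := fun i =>
    Finset.aestronglyMeasurable_fun_sum _ fun b _ => (hU _).mul (hs b)
  refine (measurable_scaledBump hε).aestronglyMeasurable.mul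
    ((((hU (i, j)).add ((hy i).mul (ht j))).add ((hy j).mul (ht i))).sub ?_)
  by_cases hij : i = j
  · simp only [hij, if_true]
    exact Finset.aestronglyMeasurable_fun_sum _ fun b _ => (hy b).mul (ht b)
  · simpa only [hij, if_false] using aestronglyMeasurable_const

lemma integrable_truncKernel (hε : LipschitzWith (1 / 2) ε) (hε0 : ∀ x, 0 ≤ ε x)
    (hu : Integrable u) (i j : Fin 3) :
    Integrable (fun q : R3 × R3 => truncKernel ε u i j q.1 q.2) (volume.prod volume) := by
  have hm : AEStronglyMeasurable (fun q : R3 × R3 => 16 * ‖u q.1‖ * scaledBump ε q.1 q.2)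
      (volume.prod volume) :=
    (hu.1.comp_fst.norm.const_mul 16).mul (measurable_scaledBump hε).aestronglyMeasurable
  have hbound : Integrable (fun q : R3 × R3 => 16 * ‖u q.1‖ * scaledBump ε q.1 q.2)
      (volume.prod volume) := by
    refine (integrable_prod_iff hm).2 ⟨Eventually.of_forall fun x =>
      (integrable_scaledBump hε0 x).const_mul (16 * ‖u x‖), ?_⟩
    refine (hu.norm.const_mul 16).mono hm.norm.integral_prod_right' (Eventually.of_forall
      fun x => ?_)
    have h0 : 0 ≤ 16 * ‖u x‖ := by positivity
    simp only [norm_mul _ (scaledBump ε x _), integral_const_mul,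
      Real.norm_of_nonneg (scaledBump_nonneg hε0 x _)]
    rw [norm_mul, norm_norm, Real.norm_of_nonneg
      (integral_nonneg (scaledBump_nonneg hε0 x))]
    exact mul_le_of_le_one_right (norm_nonneg _) (integral_scaledBump_le hε0 x)
  refine hbound.mono (aestronglyMeasurable_truncKernel hε hu.1 i j) (Eventually.of_forall
    fun q => ?_)
  exact (abs_truncKernel_le hε hε0 i j q.1 q.2).trans (le_abs_self _)

lemma integrable_apply (hu : Integrable u) (p : Fin 3 × Fin 3) : Integrable fun x => u x p :=
  (EuclideanSpace.proj (𝕜 := ℝ) p).integrable_comp hu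

lemma measurableSet_zeros (hε : LipschitzWith (1 / 2) ε) : MeasurableSet {z | ε z = 0} :=
  (isClosed_eq hε.continuous continuous_const).measurableSet

lemma integrable_truncation (hε : LipschitzWith (1 / 2) ε) (hε0 : ∀ x, 0 ≤ ε x)
    (hu : Integrable u) : Integrable (truncation ε u) := by
  have h : Integrable fun z => fun p : Fin 3 × Fin 3 =>
      {z | ε z = 0}.indicator (fun z => u z p) z + ∫ x, truncKernel ε u p.1 p.2 x z :=
    Integrable.of_eval fun p => ((integrable_apply hu p).indicator (measurableSet_zeros hε)).add
      (integrable_truncKernel hε hε0 hu p.1 p.2).integral_prod_right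
  exact (PiLp.continuousLinearEquiv 2 ℝ
    (fun _ : Fin 3 × Fin 3 => ℝ)).symm.toContinuousLinearMap.integrable_comp h

lemma sum_integral_truncKernel_mul_fderiv (hε : LipschitzWith (1 / 2) ε) {ψ : R3 → ℝ}
    {K : NNReal} (hψ : LipschitzWith K ψ) (hψs : ContDiff ℝ (⊤ : ℕ∞) ψ) {x : R3}
    (hx : DifferentiableAt ℝ ε x) (hpos : 0 < ε x) (α : Fin 3) :
    ∑ β, ∫ z, truncKernel ε u α β x z * fderiv ℝ ψ z (EuclideanSpace.single β 1) =
      ∑ β, u x (α, β) *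
        fderiv ℝ (variableSmoothing ε ψ) x (EuclideanSpace.single β 1) := by
  set e := ε x with he
  set s : Fin 3 → ℝ := fun b => fderiv ℝ ε x (EuclideanSpace.single b 1) with hs
  have hψd : Continuous (fderiv ℝ ψ) := hψs.continuous_fderiv (by simp)
  have hpc : Continuous fun y => fderiv ℝ ψ (x + e • y) := hψd.comp (by fun_prop)
  have hT : ∀ β, Continuous fun y => truncTensor (u x) s y α β := fun β => by
    unfold truncTensor
    split_ifs <;> fun_prop
  have hscale : ∀ β, ∫ z, truncKernel ε u α β x z * fderiv ℝ ψ z (EuclideanSpace.single β 1) =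
      ∫ y, radialBump y * (truncTensor (u x) s y α β *
        fderiv ℝ ψ (x + e • y) (EuclideanSpace.single β 1)) := fun β => by
    refine Eq.trans ?_ (integral_rescale (fun y => radialBump y * (truncTensor (u x) s y α β *
      fderiv ℝ ψ (x + e • y) (EuclideanSpace.single β 1))) hpos x)
    refine integral_congr_ae (Eventually.of_forall fun z => ?_)
    simp only [smul_inv_smul₀ hpos.ne', add_sub_cancel, truncKernel, scaledBump, ← he, ← hs]
    ring
  have hrot : ∀ β, ∫ y : R3, radialBump y *
      (y α * fderiv ℝ ψ (x + e • y) (EuclideanSpace.single β 1) -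
        y β * fderiv ℝ ψ (x + e • y) (EuclideanSpace.single α 1)) = 0 := fun β => by
    have hw : ContDiff ℝ (⊤ : ℕ∞) fun y => ψ (x + e • y) :=
      hψs.comp (contDiff_const.add (contDiff_id.const_smul e))
    have hwd : ∀ y v, fderiv ℝ (fun y => ψ (x + e • y)) y v =
        e * fderiv ℝ ψ (x + e • y) v := fun y v => by
      have h1 : HasFDerivAt (fun y : R3 => x + e • y) (e • ContinuousLinearMap.id ℝ R3) y :=
        ((hasFDerivAt_id y).const_smul e).const_add x
      have h2 : fderiv ℝ (fun y => ψ (x + e • y)) y = _ :=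
        ((hψs.differentiable (by simp) _).hasFDerivAt.comp y h1).fderiv
      rw [h2]
      simp
    have h := integral_radialBump_mul_rotation hw α β
    simp only [hwd] at h
    have h3 : ∀ y : R3, radialBump y *
        (y α * (e * fderiv ℝ ψ (x + e • y) (EuclideanSpace.single β 1)) -
          y β * (e * fderiv ℝ ψ (x + e • y) (EuclideanSpace.single α 1))) =
        e * (radialBump y * (y α * fderiv ℝ ψ (x + e • y) (EuclideanSpace.single β 1) -
          y β * fderiv ℝ ψ (x + e • y) (EuclideanSpace.single α 1))) := fun y => by ring
    simp only [h3, integral_const_mul] at h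
    exact (mul_eq_zero.1 h).resolve_left hpos.ne'
  simp only [hscale, fderiv_variableSmoothing hε hψ hψs hx]
  rw [← integral_finsetSum _ fun β _ => integrable_radialBump_mul (by fun_prop)]
  simp only [← Finset.mul_sum, sum_truncTensor_mul, mul_add]
  rw [integral_add (integrable_radialBump_mul (by fun_prop))
    (integrable_radialBump_mul (by fun_prop))]
  simp only [Finset.mul_sum, ← mul_add]
  rw [integral_finsetSum _ fun β _ => integrable_radialBump_mul (by fun_prop),
    integral_finsetSum _ fun β _ => integrable_radialBump_mul (by fun_prop)]
  simp only [mul_left_comm (radialBump _), integral_const_mul, hrot, mul_zero,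
    Finset.sum_const_zero, add_zero]
  rfl

lemma distDivFree_truncation (hε : LipschitzWith (1 / 2) ε) (hε0 : ∀ x, 0 ≤ ε x)
    (hu : Integrable u) (hdiv : DistDivFree u) : DistDivFree (truncation ε u) := by
  intro ψ hψs hψc α
  obtain ⟨K, hψ⟩ := ContDiff.lipschitzWith_of_hasCompactSupport hψc hψs (by simp)
  have hp : ∀ β : Fin 3, Continuous fun z => fderiv ℝ ψ z (EuclideanSpace.single β 1) := fun β =>
    (hψs.continuous_fderiv (by simp)).clm_apply continuous_const
  have hpb : ∀ (β : Fin 3) z, ‖fderiv ℝ ψ z (EuclideanSpace.single β 1)‖ ≤ K := fun β z => by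
    simpa using (fderiv ℝ ψ z).le_of_opNorm_le (norm_fderiv_le_of_lipschitz ℝ hψ)
      (EuclideanSpace.single β 1)
  have hprod : ∀ β, Integrable (fun q : R3 × R3 => truncKernel ε u α β q.1 q.2 *
      fderiv ℝ ψ q.2 (EuclideanSpace.single β 1)) (volume.prod volume) := fun β =>
    (integrable_truncKernel hε hε0 hu α β).mul_bdd (c := K)
      ((hp β).comp continuous_snd).aestronglyMeasurable (Eventually.of_forall fun q => hpb β q.2)
  have hA : ∀ β, Integrable fun z => {z | ε z = 0}.indicator (fun z => u z (α, β)) z *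
      fderiv ℝ ψ z (EuclideanSpace.single β 1) := fun β =>
    ((integrable_apply hu (α, β)).indicator (measurableSet_zeros hε)).mul_bdd (c := K)
      (hp β).aestronglyMeasurable (Eventually.of_forall (hpb β))
  have hB : ∀ β, Integrable fun z => (∫ x, truncKernel ε u α β x z) *
      fderiv ℝ ψ z (EuclideanSpace.single β 1) := fun β =>
    (integrable_truncKernel hε hε0 hu α β).integral_prod_right.mul_bdd (c := K)
      (hp β).aestronglyMeasurable (Eventually.of_forall (hpb β))
  have hswap : ∀ β, ∫ z, (∫ x, truncKernel ε u α β x z) *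
      fderiv ℝ ψ z (EuclideanSpace.single β 1) =
      ∫ x, ∫ z, truncKernel ε u α β x z * fderiv ℝ ψ z (EuclideanSpace.single β 1) := fun β => by
    simp only [← integral_mul_const]
    exact (integral_integral_swap (hprod β)).symm
  have hC : ∀ β, Integrable fun x => ∫ z, truncKernel ε u α β x z *
      fderiv ℝ ψ z (EuclideanSpace.single β 1) := fun β => (hprod β).integral_prod_left
  have hAB : ∀ β, Integrable fun z => {z | ε z = 0}.indicator (fun z => u z (α, β)) z *
      fderiv ℝ ψ z (EuclideanSpace.single β 1) + (∫ x, truncKernel ε u α β x z) *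
      fderiv ℝ ψ z (EuclideanSpace.single β 1) := fun β => (hA β).add (hB β)
  calc ∫ z, ∑ β, truncation ε u z (α, β) * fderiv ℝ ψ z (EuclideanSpace.single β 1)
      = ∑ β, ((∫ z, {z | ε z = 0}.indicator (fun z => u z (α, β)) z *
          fderiv ℝ ψ z (EuclideanSpace.single β 1)) +
        ∫ x, ∫ z, truncKernel ε u α β x z * fderiv ℝ ψ z (EuclideanSpace.single β 1)) := by
        simp only [truncation, add_mul]
        rw [integral_finsetSum _ fun β _ => hAB β]
        exact Finset.sum_congr rfl fun β _ => by rw [integral_add (hA β) (hB β), hswap]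
    _ = ∫ x, (∑ β, {z | ε z = 0}.indicator (fun z => u z (α, β)) x *
          fderiv ℝ ψ x (EuclideanSpace.single β 1) +
        ∑ β, ∫ z, truncKernel ε u α β x z * fderiv ℝ ψ z (EuclideanSpace.single β 1)) := by
        rw [integral_add (integrable_finsetSum _ fun β _ => hA β)
          (integrable_finsetSum _ fun β _ => hC β), integral_finsetSum _ fun β _ => hA β,
          integral_finsetSum _ fun β _ => hC β, Finset.sum_add_distrib]
    _ = ∫ x, ∑ β, u x (α, β) *
          fderiv ℝ (variableSmoothing ε ψ) x (EuclideanSpace.single β 1) := by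
        refine integral_congr_ae ?_
        filter_upwards [hε.ae_differentiableAt] with x hx
        rcases (hε0 x).eq_or_lt with h | h
        · simp [truncKernel, scaledBump_of_eq_zero h.symm, indicator, h.symm,
            fderiv_variableSmoothing_of_eq_zero hε hψ hψs hx h.symm]
        · rw [sum_integral_truncKernel_mul_fderiv hε hψ hψs hx h]
          simp [indicator, h.ne']
    _ = 0 := integral_sum_mul_fderiv_eq_zero_of_lipschitz (fun β => integrable_apply hu (α, β))
        (fun ψ h1 h2 => hdiv ψ h1 h2 α) (lipschitzWith_variableSmoothing hε hψ)
        (hasCompactSupport_variableSmoothing hε (by rw [← NNReal.coe_lt_coe]; norm_num) hψc)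

lemma truncation_eq_of_eq_zero (hε : LipschitzWith (1 / 2) ε) (hε0 : ∀ x, 0 ≤ ε x) {z : R3}
    (hz : ε z = 0) : truncation ε u z = u z := by
  have h : ∀ x, scaledBump ε x z = 0 := fun x => by
    by_contra h
    have h1 := dist_lt_of_scaledBump_ne_zero hε0 h
    have h2 := hε.dist_le_mul z x
    rw [hz, Real.dist_eq, zero_sub, abs_neg, abs_of_nonneg (hε0 x)] at h2
    norm_num at h2
    linarith [dist_nonneg (x := z) (y := x)]
  ext p
  simp [truncation, truncKernel, h, hz]

lemma norm_le_sum_abs (A : M33) : ‖A‖ ≤ ∑ p, |A p| := by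
  conv_lhs => rw [← (EuclideanSpace.basisFun (Fin 3 × Fin 3) ℝ).sum_repr A]
  refine (norm_sum_le _ _).trans (Finset.sum_le_sum fun p _ => ?_)
  simp [norm_smul]

lemma norm_truncation_le (hε : LipschitzWith (1 / 2) ε) (hε0 : ∀ x, 0 ≤ ε x)
    (hu : Integrable u) {z : R3} (hz : 0 < ε z) :
    ‖truncation ε u z‖ ≤ 486 * (∫ y, radialProfile y)⁻¹ * (ε z)⁻¹ ^ 3 *
      ∫ x in closedBall z (4 * ε z), ‖u x‖ := by
  set M := (∫ y, radialProfile y)⁻¹ with hM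
  have hM0 : 0 ≤ M := inv_nonneg.2 integral_radialProfile_pos.le
  have hbump : ∀ x, ‖u x‖ * scaledBump ε x z ≤
      (closedBall z (4 * ε z)).indicator (fun x => M * (27 / 8) * (ε z)⁻¹ ^ 3 * ‖u x‖) x := by
    intro x
    by_cases h : scaledBump ε x z = 0
    · rw [h, mul_zero]
      exact indicator_nonneg (fun x _ => by positivity) x
    have h1 := dist_lt_of_scaledBump_ne_zero hε0 h
    have h2 := hε.dist_le_mul z x
    rw [Real.dist_eq] at h2
    norm_num at h2
    have h3 := abs_le.1 h2
    rw [indicator_of_mem (by rw [mem_closedBall, dist_comm]; linarith)]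
    have h4 : (ε x)⁻¹ ≤ 3 / 2 * (ε z)⁻¹ := by
      have hx : 0 < ε x := dist_nonneg.trans_lt h1
      rw [inv_eq_one_div, ← div_eq_mul_inv, div_le_div_iff₀ hx hz]
      linarith
    have h5 : scaledBump ε x z ≤ M * (3 / 2 * (ε z)⁻¹) ^ 3 :=
      mul_le_mul (radialBump_le _) (pow_le_pow_left₀ (inv_nonneg.2 (hε0 x)) h4 3)
        (pow_nonneg (inv_nonneg.2 (hε0 x)) 3) hM0
    calc ‖u x‖ * scaledBump ε x z ≤ ‖u x‖ * (M * (3 / 2 * (ε z)⁻¹) ^ 3) := by gcongr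
      _ = _ := by ring
  have hentry : ∀ p, |truncation ε u z p| ≤
      54 * M * (ε z)⁻¹ ^ 3 * ∫ x in closedBall z (4 * ε z), ‖u x‖ := by
    intro p
    have h0 : truncation ε u z p = ∫ x, truncKernel ε u p.1 p.2 x z := by
      simp [truncation, indicator, hz.ne']
    rw [h0, ← Real.norm_eq_abs]
    refine (norm_integral_le_of_norm_le (g := fun x : R3 => 16 * (closedBall z (4 * ε z)).indicator
      (fun x => M * (27 / 8) * (ε z)⁻¹ ^ 3 * ‖u x‖) x)
      (((hu.norm.const_mul _).indicator isClosed_closedBall.measurableSet).const_mul 16)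
      (Eventually.of_forall fun x => ?_)).trans_eq ?_
    · refine (abs_truncKernel_le hε hε0 p.1 p.2 x z).trans ?_
      rw [mul_assoc]
      exact mul_le_mul_of_nonneg_left (hbump x) (by norm_num)
    · rw [integral_const_mul, integral_indicator isClosed_closedBall.measurableSet,
        integral_const_mul]
      ring
  refine (norm_le_sum_abs _).trans ((Finset.sum_le_card_nsmul _ _ _
    fun p _ => hentry p).trans_eq ?_)
  simp only [Finset.card_univ, Fintype.card_prod, Fintype.card_fin, nsmul_eq_mul]
  push_cast
  ring

end Truncation


/-! ### The truncation theorem -/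

/-- Half the distance to the complement of `O`. -/
def halfDistCompl (O : Set R3) (x : R3) : ℝ := 1 / 2 * infDist x Oᶜ

lemma halfDistCompl_nonneg (O : Set R3) (x : R3) : 0 ≤ halfDistCompl O x :=
  mul_nonneg (by norm_num) infDist_nonneg

lemma lipschitzWith_halfDistCompl (O : Set R3) : LipschitzWith (1 / 2) (halfDistCompl O) := by
  refine LipschitzWith.of_dist_le_mul fun x y => ?_
  have h := (lipschitz_infDist_pt Oᶜ).dist_le_mul x y
  simp only [halfDistCompl, Real.dist_eq, ← mul_sub, abs_mul] at h ⊢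
  norm_num at h ⊢
  linarith

lemma halfDistCompl_of_notMem {O : Set R3} {x : R3} (hx : x ∉ O) : halfDistCompl O x = 0 := by
  rw [halfDistCompl, infDist_zero_of_mem hx, mul_zero]

lemma halfDistCompl_pos {O : Set R3} (hO : IsOpen O) (hne : Oᶜ.Nonempty) {x : R3} (hx : x ∈ O) :
    0 < halfDistCompl O x :=
  mul_pos (by norm_num)
    ((hO.isClosed_compl.notMem_iff_infDist_pos hne).1 (notMem_compl_iff.2 hx))

/-- The bound for the truncation of `u` on the bad set, in units of `lam`. -/
def truncBound : ℝ :=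
  62208 * (∫ y, radialProfile y)⁻¹ * volume.real (ball (0 : R3) 1)

lemma truncBound_nonneg : 0 ≤ truncBound := by
  have := integral_radialProfile_pos
  unfold truncBound
  positivity

lemma norm_truncation_le_of_mem_badSet {u : R3 → M33} (hu : Integrable u) {g : R3 → ℝ}
    (hg : Integrable g) {lam : ℝ} (hgu : ∀ x, ‖u x‖ ≤ g x + lam)
    (hne : (badSet g lam)ᶜ.Nonempty) {z : R3} (hz : z ∈ badSet g lam) :
    ‖truncation (halfDistCompl (badSet g lam)) u z‖ ≤ truncBound * lam := by
  set O := badSet g lam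
  set e := halfDistCompl O z with he
  have hpos : 0 < e := halfDistCompl_pos (isOpen_badSet g lam) hne hz
  obtain ⟨p, hp, hpz⟩ := (infDist_lt_iff (x := z) (r := 4 * e) hne).1 (by
    rw [he, halfDistCompl] at hpos ⊢; linarith)
  have hgi := setIntegral_closedBall_le_of_notMem_badSet (y := z) (r := 4 * e) hp
    (by rwa [mem_ball, dist_comm])
  have hui : ∫ x in closedBall z (4 * e), ‖u x‖ ≤
      128 * e ^ 3 * volume.real (ball (0 : R3) 1) * lam := by
    have hc : IntegrableOn (fun _ => lam) (closedBall z (4 * e)) :=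
      integrableOn_const measure_closedBall_lt_top.ne
    refine (setIntegral_mono hu.norm.integrableOn (hg.integrableOn.add hc) hgu).trans ?_
    rw [integral_add' hg.integrableOn hc, setIntegral_const, smul_eq_mul]
    rw [volume_real_closedBall z (by positivity)] at hgi ⊢
    linarith
  have hM := integral_radialProfile_pos
  refine (norm_truncation_le (lipschitzWith_halfDistCompl O) (halfDistCompl_nonneg O) hu
    hpos).trans ((mul_le_mul_of_nonneg_left hui (by positivity)).trans_eq ?_)
  rw [truncBound, ← he]
  field_simp
  ring

/-- There is a dimensional constant `C > 0` such that any
divergence-free `u ∈ L¹(ℝ³; Sym(3))` admits, for each `λ > 0`, a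
divergence-free truncation `u_λ` with `‖u_λ‖_∞ ≤ Cλ`, strong `L¹`-stability and
small change of measure. -/
theorem divfree_L1_Linfty_truncation :
    ∃ C : ℝ, 0 < C ∧
      ∀ u : R3 → M33, Integrable u → (∀ x, IsSym3 (u x)) → DistDivFree u →
      ∀ lam : ℝ, 0 < lam →
      ∃ ulam : R3 → M33, Integrable ulam ∧ (∀ x, IsSym3 (ulam x)) ∧
        (∀ᵐ x ∂(volume : Measure R3), ‖ulam x‖ ≤ C * lam) ∧
        (∫ x : R3, ‖u x - ulam x‖) ≤
          C * (∫ x in {x : R3 | lam < ‖u x‖}, ‖u x‖) ∧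
        volume {x : R3 | u x ≠ ulam x} ≤
          ENNReal.ofReal (C * lam⁻¹ * (∫ x in {x : R3 | lam < ‖u x‖}, ‖u x‖)) ∧
        DistDivFree ulam := by
  have hB := truncBound_nonneg
  refine ⟨65 + 64 * truncBound, by linarith, fun u hu hsym hdiv lam hlam => ?_⟩
  set S : Set R3 := {x | lam < ‖u x‖} with hS
  set g : R3 → ℝ := S.indicator fun x => ‖u x‖ with hgdef
  have hSm : NullMeasurableSet S := nullMeasurableSet_lt aemeasurable_const hu.1.norm.aemeasurable
  have hg : Integrable g := hu.norm.indicator₀ hSm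
  have hg0 : ∀ x, 0 ≤ g x := indicator_nonneg fun x _ => norm_nonneg _
  have hgS : ∫ x in S, ‖u x‖ = ∫ x, g x := (integral_indicator₀ hSm).symm
  have hgu : ∀ x, ‖u x‖ ≤ g x + lam := fun x => by
    by_cases hx : x ∈ S
    · simp only [hgdef, indicator_of_mem hx]; linarith
    · simpa only [hgdef, indicator_of_notMem hx, zero_add] using not_lt.1 hx
  have hug : ∀ x, g x ≤ lam → ‖u x‖ ≤ lam := fun x hx => by
    by_contra! h
    rw [hgdef, indicator_of_mem (show x ∈ S from h)] at hx
    linarith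
  set O := badSet g lam with hO
  have hOvol : volume O ≤ ENNReal.ofReal (64 * lam⁻¹ * ∫ x, g x) := volume_badSet_le hg hg0 hlam
  have hOm : MeasurableSet O := (isOpen_badSet g lam).measurableSet
  have hOfin : volume O < ⊤ := hOvol.trans_lt ENNReal.ofReal_lt_top
  have hne : Oᶜ.Nonempty := by
    by_contra! h
    rw [compl_empty_iff.1 h] at hOfin
    exact absurd hOfin (by simp)
  have hg1 : 0 ≤ ∫ x, g x := integral_nonneg hg0
  have hOreal : lam * volume.real O ≤ 64 * ∫ x, g x := by
    have h := ENNReal.toReal_le_of_le_ofReal (by positivity) hOvol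
    calc lam * volume.real O ≤ lam * (64 * lam⁻¹ * ∫ x, g x) := by gcongr; exact h
      _ = _ := by field_simp
  have hε := lipschitzWith_halfDistCompl O
  have hε0 := halfDistCompl_nonneg O
  set v := truncation (halfDistCompl O) u with hv
  have hvO : ∀ z ∉ O, v z = u z := fun z hz =>
    truncation_eq_of_eq_zero hε hε0 (halfDistCompl_of_notMem hz)
  have hvle : ∀ z ∈ O, ‖v z‖ ≤ truncBound * lam := fun z hz =>
    norm_truncation_le_of_mem_badSet hu hg hgu hne hz
  have hvi : Integrable v := integrable_truncation hε hε0 hu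
  refine ⟨v, hvi, isSym3_truncation _ hsym, ?_, ?_, ?_, distDivFree_truncation hε hε0 hu hdiv⟩
  · filter_upwards [ae_le_of_notMem_badSet lam hg] with z hz
    by_cases hzO : z ∈ O
    · exact (hvle z hzO).trans (by gcongr; linarith)
    · rw [hvO z hzO]
      exact (hug z (hz hzO)).trans (le_mul_of_one_le_left hlam.le (by linarith))
  · have hc : Integrable (O.indicator fun _ => (1 + truncBound) * lam) :=
      (integrable_indicator_iff hOm).2 (integrableOn_const hOfin.ne)
    rw [hgS]
    calc ∫ x, ‖u x - v x‖
        ≤ ∫ x, (g x + O.indicator (fun _ => (1 + truncBound) * lam) x) := by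
          refine integral_mono (hu.sub hvi).norm (hg.add hc) fun x => ?_
          by_cases hx : x ∈ O
          · simp only [indicator_of_mem hx]
            linarith [norm_sub_le (u x) (v x), hgu x, hvle x hx]
          · simpa [hvO x hx, indicator_of_notMem hx] using hg0 x
      _ = (∫ x, g x) + (1 + truncBound) * (lam * volume.real O) := by
          rw [integral_add hg hc, integral_indicator hOm, setIntegral_const, smul_eq_mul]
          ring
      _ ≤ (∫ x, g x) + (1 + truncBound) * (64 * ∫ x, g x) := by gcongr
      _ = (65 + 64 * truncBound) * ∫ x, g x := by ring
  · rw [hgS]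
    refine (measure_mono fun x hx => ?_).trans (hOvol.trans (ENNReal.ofReal_le_ofReal ?_))
    · by_contra h
      exact hx (hvO x h).symm
    · gcongr
      linarith
end
end

section
/- Let w ∈ L¹(ℝ³; Sym(3)), λ > 0, c > 0, and suppose w_λ ∈ L^∞(ℝ³; Sym(3)) satisfies ‖w_λ‖_{L^∞(ℝ³)} ≤ c λ and w_λ = w almost everywhere on the set {Mw ≤ λ}. Then there exists a constant C > 0, depending only on c and the dimension 3, such that ‖w − w_λ‖_{L¹(ℝ³)} ≤ C ∫_{{|w| > λ/2}} |w| dx. -/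
/-!
Strong `L¹`-stability for maximal-function truncations (Corollary 4.8): if
`w_λ` is essentially bounded by `cλ` and agrees with `w` a.e. on `{Mw ≤ λ}`,
then `‖w − w_λ‖_{L¹} ≤ C ∫_{{|w| > λ/2}} |w| dx`.  The condition `Mw(x) ≤ λ`
is encoded as: every ball average of `‖w‖` centered at `x` is `≤ λ`.
-/

noncomputable section
open MeasureTheory
open scoped ENNReal

/-- Weak-type (1,1) estimate for the centered maximal function. -/
lemma mul_measure_setOf_mul_le_setLIntegral_closedBall_le {E : Type*} [NormedAddCommGroup E]
    [NormedSpace ℝ E] [FiniteDimensional ℝ E] [Nontrivial E] [MeasurableSpace E] [BorelSpace E]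
    (μ : Measure E) [μ.IsAddHaarMeasure] (f : E → ℝ≥0∞) (hf : ∫⁻ x, f x ∂μ ≠ ∞)
    {a : ℝ≥0∞} (ha : a ≠ 0) (ha' : a ≠ ∞) :
    a * μ {x | ∃ r : ℝ, 0 < r ∧
        a * μ (Metric.closedBall x r) ≤ ∫⁻ y in Metric.closedBall x r, f y ∂μ} ≤
      5 ^ Module.finrank ℝ E * ∫⁻ x, f x ∂μ := by
  set s := {x | ∃ r : ℝ, 0 < r ∧
    a * μ (Metric.closedBall x r) ≤ ∫⁻ y in Metric.closedBall x r, f y ∂μ}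
  set d := Module.finrank ℝ E
  have hdpos : d ≠ 0 := Module.finrank_pos.ne'
  have hex : ∀ x ∈ s, ∃ r : ℝ, 0 < r ∧
    a * μ (Metric.closedBall x r) ≤ ∫⁻ y in Metric.closedBall x r, f y ∂μ := fun x hx => hx
  choose! r hr hle using hex
  have hball0 : μ (Metric.ball (0 : E) 1) ≠ 0 := (Metric.measure_ball_pos μ 0 one_pos).ne'
  have hballtop : μ (Metric.ball (0 : E) 1) ≠ ∞ := measure_ball_lt_top.ne
  set K := ((∫⁻ x, f x ∂μ) / (a * μ (Metric.ball (0 : E) 1))).toReal with hK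
  have hbound : ∀ x ∈ s, r x ≤ max 1 K := by
    intro x hx
    rcases le_total (r x) 1 with h1 | h1
    · exact h1.trans (le_max_left _ _)
    refine le_trans ?_ (le_max_right _ _)
    refine (le_self_pow₀ h1 hdpos).trans ?_
    rw [hK, ← ENNReal.ofReal_le_iff_le_toReal
      (ENNReal.div_ne_top hf (mul_ne_zero ha hball0)),
      ENNReal.le_div_iff_mul_le (Or.inl (mul_ne_zero ha hball0))
        (Or.inl (ENNReal.mul_ne_top ha' hballtop)), mul_left_comm,
      ← Measure.addHaar_closedBall μ x (hr x hx).le]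
    exact (hle x hx).trans (setLIntegral_le_lintegral _ _)
  obtain ⟨u, hus, hdisj, hcov⟩ := Vitali.exists_disjoint_subfamily_covering_enlargement_closedBall
    s id r (max 1 K) hbound 5 (by norm_num)
  simp only [id_eq] at hdisj hcov
  have hcount : u.Countable := hdisj.countable_of_nonempty_interior fun x hx =>
    (Metric.nonempty_ball.2 (hr x (hus hx))).mono Metric.ball_subset_interior_closedBall
  have hsub : s ⊆ ⋃ x ∈ u, Metric.closedBall x (5 * r x) := by
    intro x hx
    obtain ⟨b, hb, hxb⟩ := hcov x hx
    exact Set.mem_biUnion hb (hxb (Metric.mem_closedBall_self (hr x hx).le))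
  have hscale : ∀ x ∈ u, μ (Metric.closedBall x (5 * r x)) =
      5 ^ d * μ (Metric.closedBall x (r x)) := by
    intro x hx
    have hrx := (hr x (hus hx)).le
    rw [Measure.addHaar_closedBall μ x hrx, Measure.addHaar_closedBall μ x (by positivity),
      mul_pow, ENNReal.ofReal_mul (by positivity), ENNReal.ofReal_pow (by norm_num), mul_assoc,
      ENNReal.ofReal_ofNat]
  calc a * μ s ≤ a * ∑' x : u, μ (Metric.closedBall (x : E) (5 * r x)) := by
        gcongr
        exact (measure_mono hsub).trans (measure_biUnion_le μ hcount _)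
    _ = 5 ^ d * ∑' x : u, a * μ (Metric.closedBall (x : E) (r x)) := by
        rw [tsum_congr fun x : u => hscale x x.2, ENNReal.tsum_mul_left, ENNReal.tsum_mul_left,
          mul_left_comm]
    _ ≤ 5 ^ d * ∑' x : u, ∫⁻ y in Metric.closedBall (x : E) (r x), f y ∂μ := by
        gcongr with x
        exact hle x (hus x.2)
    _ = 5 ^ d * ∫⁻ y in ⋃ x ∈ u, Metric.closedBall x (r x), f y ∂μ := by
        rw [lintegral_biUnion hcount (fun _ _ => Metric.isClosed_closedBall.measurableSet) hdisj]
    _ ≤ 5 ^ d * ∫⁻ x, f x ∂μ := by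
        gcongr
        exact Measure.restrict_le_self

/-- For every `c > 0` there is a constant `C > 0` (depending
only on `c` and the dimension `3`) such that: whenever `w ∈ L¹(ℝ³; Sym(3))`,
`λ > 0` and `w_λ ∈ L^∞(ℝ³; Sym(3))` satisfies `‖w_λ‖_∞ ≤ cλ` and `w_λ = w`
a.e. on `{Mw ≤ λ}`, then `∫ |w − w_λ| dx ≤ C ∫_{{|w| > λ/2}} |w| dx`. -/
theorem truncation_strong_L1_stability (c : ℝ) (hc : 0 < c) :
    ∃ C : ℝ, 0 < C ∧
      ∀ w : R3 → M33, Integrable w → (∀ x, IsSym3 (w x)) →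
      ∀ lam : ℝ, 0 < lam →
      ∀ wlam : R3 → M33, AEStronglyMeasurable wlam (volume : Measure R3) →
        (∀ x, IsSym3 (wlam x)) →
        (∀ᵐ x ∂(volume : Measure R3), ‖wlam x‖ ≤ c * lam) →
        (∀ᵐ x ∂(volume : Measure R3),
          (∀ r : ℝ, 0 < r → (⨍ y in Metric.ball x r, ‖w y‖) ≤ lam) →
            wlam x = w x) →
        (∫⁻ x : R3, (‖w x - wlam x‖₊ : ℝ≥0∞)) ≤
          ENNReal.ofReal
            (C * (∫ x in {x : R3 | lam / 2 < ‖w x‖}, ‖w x‖)) := by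
  refine ⟨1 + 125 * (1 + 2 * c), by positivity, ?_⟩
  intro w hw _ lam hlam wlam _ _ hbd heq
  set S := {x : R3 | lam / 2 < ‖w x‖}
  have hSm : NullMeasurableSet S :=
    nullMeasurableSet_lt aemeasurable_const hw.norm.aestronglyMeasurable.aemeasurable
  set v : R3 → ℝ := S.indicator fun x => ‖w x‖ with hv
  have hv0 : ∀ x, 0 ≤ v x := fun x => Set.indicator_nonneg (fun _ _ => norm_nonneg _) x
  have hvint : Integrable v := hw.norm.indicator₀ hSm
  have hwv : ∀ x, ‖w x‖ ≤ lam / 2 + v x := by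
    intro x
    by_cases hx : x ∈ S
    · rw [hv, Set.indicator_of_mem hx]
      linarith
    · rw [hv, Set.indicator_of_notMem hx, add_zero]
      exact not_lt.1 hx
  set I := ∫⁻ x, ENNReal.ofReal (v x)
  have hIeq : ENNReal.ofReal (∫ x in S, ‖w x‖) = I := by
    rw [← integral_indicator₀ hSm,
      ofReal_integral_eq_lintegral_ofReal hvint (Filter.Eventually.of_forall hv0)]
  have hItop : I ≠ ∞ := hIeq ▸ ENNReal.ofReal_ne_top
  set a := ENNReal.ofReal (lam / 2) with ha
  set E : Set R3 := {x | ∃ r : ℝ, 0 < r ∧ a * volume (Metric.closedBall x r) ≤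
    ∫⁻ y in Metric.closedBall x r, ENNReal.ofReal (v y)}
  have hweak : a * volume E ≤ 125 * I := by
    have h := mul_measure_setOf_mul_le_setLIntegral_closedBall_le (volume : Measure R3)
      (fun x => ENNReal.ofReal (v x)) hItop (a := a)
      (by simpa [ha] using hlam) ENNReal.ofReal_ne_top
    rwa [finrank_euclideanSpace_fin, show (5 : ℝ≥0∞) ^ 3 = 125 by norm_num] at h
  have hgood : ∀ x, x ∉ E → ∀ r : ℝ, 0 < r → (⨍ y in Metric.ball x r, ‖w y‖) ≤ lam := by
    intro x hx r hr
    by_contra! hlt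
    refine hx ⟨r, hr, ?_⟩
    have hpos : 0 < volume.real (Metric.ball x r) :=
      ENNReal.toReal_pos (Metric.measure_ball_pos _ _ hr).ne' measure_ball_lt_top.ne
    rw [setAverage_eq, smul_eq_mul, ← div_eq_inv_mul, lt_div_iff₀ hpos] at hlt
    have hconst : IntegrableOn (fun _ : R3 => lam / 2) (Metric.ball x r) :=
      integrableOn_const measure_ball_lt_top.ne
    have hle : ∫ y in Metric.ball x r, ‖w y‖ ≤
        ∫ y in Metric.ball x r, (lam / 2 + v y) :=
      integral_mono hw.norm.integrableOn
        (hconst.add hvint.integrableOn) hwv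
    rw [integral_add hconst hvint.integrableOn,
      setIntegral_const, smul_eq_mul] at hle
    have hreal : lam / 2 * volume.real (Metric.ball x r) ≤ ∫ y in Metric.ball x r, v y := by
      linarith
    rw [Measure.addHaar_closedBall_eq_addHaar_ball]
    calc a * volume (Metric.ball x r)
        = ENNReal.ofReal (lam / 2 * volume.real (Metric.ball x r)) := by
          rw [ENNReal.ofReal_mul (by positivity), ofReal_measureReal measure_ball_lt_top.ne]
      _ ≤ ENNReal.ofReal (∫ y in Metric.ball x r, v y) := ENNReal.ofReal_le_ofReal hreal
      _ = ∫⁻ y in Metric.ball x r, ENNReal.ofReal (v y) :=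
          ofReal_integral_eq_lintegral_ofReal hvint.integrableOn
            (Filter.Eventually.of_forall hv0)
      _ ≤ _ := lintegral_mono_set Metric.ball_subset_closedBall
  set T := toMeasurable volume E
  have hpt : ∀ᵐ x : R3, (‖w x - wlam x‖₊ : ℝ≥0∞) ≤
      ENNReal.ofReal (v x) + T.indicator (fun _ => ENNReal.ofReal (lam / 2 + c * lam)) x := by
    filter_upwards [hbd, heq] with x hx1 hx2
    by_cases hxT : x ∈ T
    · rw [Set.indicator_of_mem hxT, ← ENNReal.ofReal_add (hv0 x) (by positivity),
        ← enorm_eq_nnnorm, ← ofReal_norm]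
      refine ENNReal.ofReal_le_ofReal ((norm_sub_le _ _).trans ?_)
      linarith [hwv x]
    · rw [hx2 (hgood x fun h => hxT (subset_toMeasurable _ _ h))]
      simp
  have hconst : ENNReal.ofReal (lam / 2 + c * lam) = ENNReal.ofReal (1 + 2 * c) * a := by
    rw [ha, ← ENNReal.ofReal_mul (by positivity)]
    congr 1
    ring
  calc (∫⁻ x : R3, (‖w x - wlam x‖₊ : ℝ≥0∞))
      ≤ ∫⁻ x : R3, (ENNReal.ofReal (v x) +
          T.indicator (fun _ => ENNReal.ofReal (lam / 2 + c * lam)) x) := lintegral_mono_ae hpt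
    _ = I + ENNReal.ofReal (1 + 2 * c) * (a * volume E) := by
        rw [lintegral_add_right _ (measurable_const.indicator (measurableSet_toMeasurable _ _)),
          lintegral_indicator_const (measurableSet_toMeasurable _ _), measure_toMeasurable,
          hconst, mul_assoc]
    _ ≤ I + ENNReal.ofReal (1 + 2 * c) * (125 * I) := by gcongr
    _ = ENNReal.ofReal ((1 + 125 * (1 + 2 * c)) * ∫ x in S, ‖w x‖) := by
        rw [ENNReal.ofReal_mul (by positivity), hIeq,
          ENNReal.ofReal_add (p := 1) (q := 125 * (1 + 2 * c)) (by norm_num) (by positivity),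
          ENNReal.ofReal_mul (p := 125) (by norm_num),
          ENNReal.ofReal_one, ENNReal.ofReal_ofNat]
        ring
end
end

section
/- Let 𝒪 ⊆ ℝ³ be open and let (φ_l)_{l∈ℕ} be a family of smooth functions φ_l ∈ C_c^∞(𝒪; [0,1]) such that every point of 𝒪 has a neighbourhood on which all but finitely many φ_l vanish identically, and Σ_l φ_l ≡ 1 on 𝒪. Let B : ℕ³ → ℝ satisfy the cocycle identity B(i,j,k) − B(m,j,k) − B(i,m,k) − B(i,j,m) = 0 for all i, j, k, m ∈ ℕ. Then for all multi-indices a, b, c ∈ ℕ³ with |a|, |b|, |c| ≥ 1 one has Σ_{i,j,k ∈ ℕ} ∂^a φ_k(x) ∂^b φ_j(x) ∂^c φ_i(x) B(i,j,k) = 0 for every x ∈ 𝒪 (the sum being locally finite). -/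
/-!
Vanishing of triple sums of partition-of-unity derivatives against cocycles
(Lemma 7.1): if `B` satisfies the cocycle identity, then
`Σ_{i,j,k} ∂^a φ_k ∂^b φ_j ∂^c φ_i B(i,j,k) = 0` on `𝒪` for all multi-indices
`a, b, c` of order `≥ 1`.
-/

noncomputable section
open MeasureTheory

/-- The partial derivative `∂^a f (x)` for a multi-index `a : Fin 3 → ℕ`,
realized as the iterated Fréchet derivative of order `|a| = a 0 + a 1 + a 2`
evaluated on the corresponding block of coordinate directions (for smooth `f`
mixed partials commute, so this is the usual `∂₁^{a 0} ∂₂^{a 1} ∂₃^{a 2} f`). -/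
def mderiv (a : Fin 3 → ℕ) (f : R3 → ℝ) (x : R3) : ℝ :=
  iteratedFDeriv ℝ (a 0 + a 1 + a 2) f x fun i =>
    if (i : ℕ) < a 0 then EuclideanSpace.single 0 1
    else if (i : ℕ) < a 0 + a 1 then EuclideanSpace.single 1 1
    else EuclideanSpace.single 2 1

lemma mderiv_congr {f g : R3 → ℝ} {x : R3} (h : f =ᶠ[nhds x] g) (a : Fin 3 → ℕ) :
    mderiv a f x = mderiv a g x := by
  simp only [mderiv, (h.iteratedFDeriv ℝ _).eq_of_nhds]

lemma mderiv_const {a : Fin 3 → ℕ} (ha : 1 ≤ a 0 + a 1 + a 2) (r : ℝ) (x : R3) :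
    mderiv a (fun _ => r) x = 0 := by
  simp [mderiv, iteratedFDeriv_const_of_ne (𝕜 := ℝ) (E := R3)
    (show a 0 + a 1 + a 2 ≠ 0 by omega) r]

lemma mderiv_sum {ι : Type*} (S : Finset ι) {f : ι → R3 → ℝ}
    (hf : ∀ l, ContDiff ℝ (⊤ : ℕ∞) (f l)) (a : Fin 3 → ℕ) (x : R3) :
    mderiv a (fun y => ∑ l ∈ S, f l y) x = ∑ l ∈ S, mderiv a (f l) x := by
  have h := iteratedFDeriv_sum (𝕜 := ℝ) (i := a 0 + a 1 + a 2) (u := S) (f := f)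
    (fun l _ => (hf l).of_le (by exact_mod_cast le_top))
  simp only [mderiv, h, Finset.sum_apply, sum_apply]

/-- The triple sum of a cocycle against three finite families of weights of total weight zero
vanishes. -/
lemma sum_mul_cocycle_eq_zero {ι : Type*} (S : Finset ι) {u v w : ι → ℝ} {B : ι → ι → ι → ℝ}
    (m : ι) (hB : ∀ i j k, B i j k - B m j k - B i m k - B i j m = 0)
    (hu : ∑ k ∈ S, u k = 0) (hv : ∑ j ∈ S, v j = 0) (hw : ∑ i ∈ S, w i = 0) :
    ∑ i ∈ S, ∑ j ∈ S, ∑ k ∈ S, u k * v j * w i * B i j k = 0 := by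
  have hsplit : ∀ i j k, u k * v j * w i * B i j k =
      w i * (u k * v j * B m j k) + v j * (u k * w i * B i m k)
        + u k * (v j * w i * B i j m) := by
    intro i j k
    linear_combination (u k * v j * w i) * hB i j k
  have h₁ : ∑ i ∈ S, ∑ j ∈ S, ∑ k ∈ S, w i * (u k * v j * B m j k) = 0 := by
    simp only [← Finset.mul_sum, ← Finset.sum_mul, hw, zero_mul]
  have h₂ : ∑ i ∈ S, ∑ j ∈ S, ∑ k ∈ S, v j * (u k * w i * B i m k) = 0 := by
    simp only [← Finset.mul_sum, ← Finset.sum_mul, hv, zero_mul, Finset.sum_const_zero]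
  have h₃ : ∑ i ∈ S, ∑ j ∈ S, ∑ k ∈ S, u k * (v j * w i * B i j m) = 0 := by
    simp only [← Finset.sum_mul, hu, zero_mul, Finset.sum_const_zero]
  simp only [hsplit, Finset.sum_add_distrib, h₁, h₂, h₃, add_zero]

/-- Let `𝒪 ⊆ ℝ³` be open and `(φ_l)` a locally finite smooth
partition of unity on `𝒪` with `φ_l ∈ C_c^∞(𝒪; [0,1])`.  If `B : ℕ³ → ℝ`
satisfies the cocycle identity, then for all multi-indices `a, b, c` of order
at least one, the (locally finite) triple sum
`Σ_{i,j,k} ∂^a φ_k ∂^b φ_j ∂^c φ_i B(i,j,k)` vanishes at every point of `𝒪`. -/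
theorem partition_cocycle_sum_vanishes
    (O : Set R3) (hO : IsOpen O) (φ : ℕ → R3 → ℝ)
    (hsm : ∀ l, ContDiff ℝ (⊤ : ℕ∞) (φ l))
    (hsupp : ∀ l, HasCompactSupport (φ l) ∧ tsupport (φ l) ⊆ O)
    (hrange : ∀ l x, φ l x ∈ Set.Icc (0 : ℝ) 1)
    (hlocfin : ∀ x ∈ O, ∃ U ∈ nhds x, {l : ℕ | ¬∀ y ∈ U, φ l y = 0}.Finite)
    (hsum : ∀ x ∈ O, ∑' l : ℕ, φ l x = 1)
    (B : ℕ → ℕ → ℕ → ℝ)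
    (hB : ∀ i j k m : ℕ, B i j k - B m j k - B i m k - B i j m = 0)
    (a b c : Fin 3 → ℕ)
    (ha : 1 ≤ a 0 + a 1 + a 2) (hb : 1 ≤ b 0 + b 1 + b 2)
    (hc : 1 ≤ c 0 + c 1 + c 2)
    (x : R3) (hx : x ∈ O) :
    ∑' i : ℕ, ∑' j : ℕ, ∑' k : ℕ,
      mderiv a (φ k) x * mderiv b (φ j) x * mderiv c (φ i) x * B i j k = 0 := by
  obtain ⟨U, hU, hfin⟩ := hlocfin x hx
  set S : Finset ℕ := hfin.toFinset
  have hS : ∀ l ∉ S, ∀ y ∈ U, φ l y = 0 := fun l hl => by simpa [S] using hl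
  have hvanish : ∀ d : Fin 3 → ℕ, 1 ≤ d 0 + d 1 + d 2 → ∀ l ∉ S, mderiv d (φ l) x = 0 := by
    intro d hd l hl
    rw [mderiv_congr (g := fun _ => 0) (Filter.mem_of_superset hU (hS l hl)), mderiv_const hd]
  have hzero : ∀ d : Fin 3 → ℕ, 1 ≤ d 0 + d 1 + d 2 → ∑ l ∈ S, mderiv d (φ l) x = 0 := by
    intro d hd
    have hone : (fun y => ∑ l ∈ S, φ l y) =ᶠ[nhds x] fun _ => 1 := by
      filter_upwards [hU, hO.mem_nhds hx] with y hyU hyO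
      rw [← hsum y hyO, tsum_eq_sum fun l hl => hS l hl y hyU]
    rw [← mderiv_sum S hsm, mderiv_congr hone, mderiv_const hd]
  rw [tsum_eq_sum (s := S) fun i hi => by simp [hvanish c hc i hi]]
  refine Eq.trans (Finset.sum_congr rfl fun i _ => ?_)
    (sum_mul_cocycle_eq_zero S 0 (fun i j k => hB i j k 0) (hzero a ha) (hzero b hb) (hzero c hc))
  rw [tsum_eq_sum (s := S) fun j hj => by simp [hvanish b hb j hj]]
  refine Finset.sum_congr rfl fun j _ => ?_
  exact tsum_eq_sum fun k hk => by simp [hvanish a ha k hk]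
end
end

section
/- Let K ⊆ Sym(3) be a non-empty compact set of real symmetric 3×3 matrices. Then: (1) K ⊆ K^(∞); (2) K^(∞) is compact; (3) K^(∞) is a symmetric div-quasiconvex set; and (4) if L ⊆ Sym(3) is any compact symmetric div-quasiconvex set with K ⊆ L, then K^(∞) ⊆ L. In other words, K^(∞) is the smallest compact symmetric div-quasiconvex set containing K. -/
/-!
Symmetric div-quasiconvex hulls of compact sets of symmetric 3×3 matrices.

`M33` encodes the real 3×3 matrices with the Frobenius norm, as the Euclidean
space indexed by `Fin 3 × Fin 3`; symmetric matrices are singled out by the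
predicate `IsSym3`.  The torus `𝕋₃ = ℝ³/ℤ³` is encoded via `ℤ³`-periodic
functions on `ℝ³` (with the unit cube `unitBox` as fundamental domain, of
measure one, so integrals over `unitBox` are the normalized torus integrals).
-/

noncomputable section
open MeasureTheory

/-- The underlying space `ℝ³` of the torus `𝕋₃ = ℝ³/ℤ³`. -/
abbrev Dom3 : Type := Fin 3 → ℝ

/-- The fundamental domain `[0,1)³` of the torus. -/
def unitBox : Set Dom3 := Set.univ.pi fun _ => Set.Ico (0 : ℝ) 1

/-- `ℤ³`-periodicity: the defining property of functions on the torus `𝕋₃`. -/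
def PeriodicZ3 {E : Type*} (φ : Dom3 → E) : Prop :=
  ∀ (x : Dom3) (m : Fin 3 → ℤ), φ (x + fun i => (m i : ℝ)) = φ x

/-- Pointwise row-wise divergence-freeness of a (smooth) matrix field. -/
def DivFree3 (φ : Dom3 → M33) : Prop :=
  ∀ (x : Dom3) (α : Fin 3),
    ∑ β : Fin 3, fderiv ℝ (fun y => φ y (α, β)) x (Pi.single β 1) = 0

/-- The test class `𝒯`: smooth maps `φ : 𝕋₃ → Sym(3)` with zero mean and
`div φ = 0` (row-wise). -/
def TestClass : Set (Dom3 → M33) :=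
  {φ | ContDiff ℝ (⊤ : ℕ∞) φ ∧ PeriodicZ3 φ ∧ (∀ x, IsSym3 (φ x)) ∧ DivFree3 φ ∧
    (∫ x in unitBox, φ x) = 0}

/-- `F : Sym(3) → ℝ` is symmetric div-quasiconvex if
`F ξ ≤ ∫_{𝕋₃} F (ξ + φ x) dx` for all symmetric `ξ` and all `φ ∈ 𝒯`. -/
def SymDivQC (F : M33 → ℝ) : Prop :=
  ∀ ξ : M33, IsSym3 ξ → ∀ φ ∈ TestClass, F ξ ≤ ∫ x in unitBox, F (ξ + φ x)

/-- The symmetric div-quasiconvex envelope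
`𝒬F(ξ) = inf { ∫_{𝕋₃} F(ξ + φ(x)) dx : φ ∈ 𝒯 }`. -/
def sdqcEnvelope (F : M33 → ℝ) (ξ : M33) : ℝ :=
  sInf ((fun φ : Dom3 → M33 => ∫ x in unitBox, F (ξ + φ x)) '' TestClass)

/-- The `p`-symmetric div-quasiconvex hull
`K^(p) = { ξ ∈ Sym(3) : 𝒬f_p(ξ) = 0 }` with `f_p(ξ) = dist(ξ,K)^p`. -/
def hullP (K : Set M33) (p : ℝ) : Set M33 :=
  {ξ | IsSym3 ξ ∧ sdqcEnvelope (fun η => Metric.infDist η K ^ p) ξ = 0}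

/-- The `∞`-symmetric div-quasiconvex hull: all symmetric `ξ` with
`g ξ ≤ max_K g` for every symmetric div-quasiconvex continuous
`g : Sym(3) → [0,∞)`. -/
def hullInf (K : Set M33) : Set M33 :=
  {ξ | IsSym3 ξ ∧ ∀ g : M33 → ℝ, Continuous g → (∀ η, 0 ≤ g η) → SymDivQC g →
    g ξ ≤ sSup (g '' K)}

/-- A compact `S ⊆ Sym(3)` is a symmetric div-quasiconvex set if every
symmetric `ξ ∉ S` is separated from `S` by a symmetric div-quasiconvex
continuous `g : Sym(3) → [0,∞)`. -/
def IsSymDivQCSet (S : Set M33) : Prop :=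
  ∀ ξ : M33, IsSym3 ξ → ξ ∉ S →
    ∃ g : M33 → ℝ, Continuous g ∧ (∀ η, 0 ≤ g η) ∧ SymDivQC g ∧ sSup (g '' S) < g ξ

theorem volume_unitBox : volume unitBox = 1 := by
  rw [unitBox, volume_pi_pi]
  simp

theorem TestClass.integrableOn {φ : Dom3 → M33} (hφ : φ ∈ TestClass) :
    IntegrableOn φ unitBox := by
  have hcpt : IsCompact (Set.univ.pi fun _ : Fin 3 => Set.Icc (0 : ℝ) 1) :=
    isCompact_univ_pi fun _ => isCompact_Icc
  exact (hφ.1.continuous.continuousOn.integrableOn_compact hcpt).mono_set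
    (Set.pi_mono fun _ _ => Set.Ico_subset_Icc_self)

theorem symDivQC_norm : SymDivQC fun η => ‖η‖ := by
  intro ξ _ φ hφ
  have hint := TestClass.integrableOn hφ
  have hconst : IntegrableOn (fun _ : Dom3 => ξ) unitBox :=
    integrableOn_const (by simp [volume_unitBox])
  have hmean : ∫ x in unitBox, (ξ + φ x) = ξ := by
    rw [integral_add hconst hint, hφ.2.2.2.2]
    simp [measureReal_def, volume_unitBox]
  calc ‖ξ‖ = ‖∫ x in unitBox, (ξ + φ x)‖ := by rw [hmean]
    _ ≤ ∫ x in unitBox, ‖ξ + φ x‖ := norm_integral_le_integral_norm _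

theorem isClosed_isSym3 : IsClosed {ξ : M33 | IsSym3 ξ} := by
  simp only [IsSym3, Set.ofPred_forall]
  exact isClosed_iInter fun i => isClosed_iInter fun j =>
    isClosed_eq (by fun_prop) (by fun_prop)

theorem isClosed_hullInf (K : Set M33) : IsClosed (hullInf K) := by
  simp only [hullInf, Set.ofPred_and, Set.ofPred_forall]
  exact isClosed_isSym3.inter <| isClosed_iInter fun g => isClosed_iInter fun hg => isClosed_iInter fun _ =>
    isClosed_iInter fun _ => isClosed_le hg continuous_const

theorem isCompact_hullInf (K : Set M33) : IsCompact (hullInf K) := by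
  refine (isCompact_closedBall (0 : M33) (sSup ((fun η => ‖η‖) '' K))).of_isClosed_subset
    (isClosed_hullInf K) fun ξ hξ => ?_
  rw [mem_closedBall_zero_iff]
  exact hξ.2 _ continuous_norm norm_nonneg symDivQC_norm

theorem subset_hullInf {K : Set M33} (hcomp : IsCompact K) (hsym : ∀ A ∈ K, IsSym3 A) :
    K ⊆ hullInf K := fun A hA =>
  ⟨hsym A hA, fun _ hg _ _ => le_csSup (hcomp.image hg).bddAbove (Set.mem_image_of_mem _ hA)⟩

theorem isSymDivQCSet_hullInf {K : Set M33} (hne : (hullInf K).Nonempty) :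
    IsSymDivQCSet (hullInf K) := by
  intro ξ hξ hξK
  by_contra! h
  refine hξK ⟨hξ, fun g hg hg0 hqc => (h g hg hg0 hqc).trans ?_⟩
  refine csSup_le (hne.image g) ?_
  rintro _ ⟨η, hη, rfl⟩
  exact hη.2 g hg hg0 hqc

theorem hullInf_subset {K L : Set M33} (hne : K.Nonempty) (hL : IsCompact L)
    (hqcL : IsSymDivQCSet L) (hKL : K ⊆ L) : hullInf K ⊆ L := by
  intro ξ hξ
  by_contra hξL
  obtain ⟨g, hg, hg0, hqc, hlt⟩ := hqcL ξ hξ.1 hξL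
  exact absurd hlt (not_lt.2 ((hξ.2 g hg hg0 hqc).trans
    (csSup_le_csSup (hL.image hg).bddAbove (hne.image g) (Set.image_mono hKL))))

/-- For a non-empty compact `K ⊆ Sym(3)`, the hull `K^(∞)` is
the smallest compact symmetric div-quasiconvex set containing `K`. -/
theorem hullInf_smallest (K : Set M33) (hne : K.Nonempty) (hcomp : IsCompact K)
    (hsym : ∀ A ∈ K, IsSym3 A) :
    K ⊆ hullInf K ∧ IsCompact (hullInf K) ∧ IsSymDivQCSet (hullInf K) ∧
    ∀ L : Set M33, IsCompact L → (∀ A ∈ L, IsSym3 A) → IsSymDivQCSet L → K ⊆ L →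
      hullInf K ⊆ L := by
  have hsub := subset_hullInf hcomp hsym
  exact ⟨hsub, isCompact_hullInf K, isSymDivQCSet_hullInf (hne.mono hsub),
    fun _ hL _ hqcL hKL => hullInf_subset hne hL hqcL hKL⟩
end
end

section
/- Let u ∈ L¹(ℝ³; Sym(3)), let λ > 0 and c > 0, and let (w^j)_{j∈ℕ} ⊂ L¹(ℝ³; Sym(3)) satisfy ‖w^j − u‖_{L¹(ℝ³)} ≤ 2^{-j} λ for all j ∈ ℕ. Suppose (g^j)_{j∈ℕ} ⊂ L^∞(ℝ³; Sym(3)) satisfy ‖g^j‖_{L^∞(ℝ³)} ≤ c λ for all j and g^j = w^j almost everywhere on the set {M w^j ≤ 4λ}. Then ∫_{{Mu ≤ 2λ}} |g^j − u| dx → 0 as j → ∞; in particular g^j → u in L¹ on the set {Mu ≤ 2λ}. -/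
/-!
Convergence of truncations on the good set (the claim in the proof of
Theorem 1.2, Section 4.6): if `w^j → u` in `L¹` at geometric rate and `g^j`
are uniformly bounded functions agreeing with `w^j` on `{Mw^j ≤ 4λ}`, then
`g^j → u` in `L¹` on `{Mu ≤ 2λ}`.  The condition `Mw(x) ≤ t` on the centered
Hardy–Littlewood maximal function is encoded as: every ball average of `‖w‖`
centered at `x` is `≤ t`.
-/

noncomputable section
open MeasureTheory Filter
open scoped ENNReal

/-- If some average of `‖f‖` over the ball `B_r(x)` exceeds `t`, then the measure of the
corresponding closed ball is controlled by the integral of `‖f‖` over it. -/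
lemma measure_closedBall_le_of_lt_average {E F : Type*} [NormedAddCommGroup E] [NormedSpace ℝ E]
    [FiniteDimensional ℝ E] [Nontrivial E] [MeasurableSpace E] [BorelSpace E]
    [NormedAddCommGroup F] (μ : Measure E) [μ.IsAddHaarMeasure] {f : E → F}
    (hf : Integrable f μ) {t : ℝ} (ht : 0 < t) {x : E} {r : ℝ} (hr : 0 < r)
    (h : t < ⨍ y in Metric.ball x r, ‖f y‖ ∂μ) :
    μ (Metric.closedBall x r) ≤ (∫⁻ y in Metric.closedBall x r, ‖f y‖ₑ ∂μ) / ENNReal.ofReal t := by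
  have hpos : 0 < μ.real (Metric.ball x r) :=
    ENNReal.toReal_pos (Metric.measure_ball_pos μ x hr).ne' measure_ball_lt_top.ne
  rw [setAverage_eq, smul_eq_mul, ← div_eq_inv_mul, lt_div_iff₀ hpos] at h
  rw [ENNReal.le_div_iff_mul_le (Or.inl (by simpa using ht)) (Or.inl ENNReal.ofReal_ne_top),
    μ.addHaar_closedBall_eq_addHaar_ball]
  calc μ (Metric.ball x r) * ENNReal.ofReal t
      = ENNReal.ofReal (t * μ.real (Metric.ball x r)) := by
        rw [ENNReal.ofReal_mul ht.le, ofReal_measureReal measure_ball_lt_top.ne, mul_comm]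
    _ ≤ ENNReal.ofReal (∫ y in Metric.ball x r, ‖f y‖ ∂μ) := ENNReal.ofReal_le_ofReal h.le
    _ = ∫⁻ y in Metric.ball x r, ‖f y‖ₑ ∂μ := ofReal_integral_norm_eq_lintegral_enorm hf.restrict
    _ ≤ ∫⁻ y in Metric.closedBall x r, ‖f y‖ₑ ∂μ :=
        lintegral_mono_set Metric.ball_subset_closedBall

/-- The weak type `(1,1)` inequality for the centered Hardy–Littlewood maximal function. -/
lemma measure_exists_lt_average_norm_le {E F : Type*} [NormedAddCommGroup E] [NormedSpace ℝ E]
    [FiniteDimensional ℝ E] [Nontrivial E] [MeasurableSpace E] [BorelSpace E]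
    [NormedAddCommGroup F] (μ : Measure E) [μ.IsAddHaarMeasure] {f : E → F}
    (hf : Integrable f μ) {t : ℝ} (ht : 0 < t) :
    μ {x | ∃ r : ℝ, 0 < r ∧ t < ⨍ y in Metric.ball x r, ‖f y‖ ∂μ} ≤
      ENNReal.ofReal (4 ^ Module.finrank ℝ E) * ((∫⁻ y, ‖f y‖ₑ ∂μ) / ENNReal.ofReal t) := by
  set A := {x | ∃ r : ℝ, 0 < r ∧ t < ⨍ y in Metric.ball x r, ‖f y‖ ∂μ} with hA
  set K := (∫⁻ y, ‖f y‖ₑ ∂μ) / ENNReal.ofReal t with hK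
  have hKtop : K ≠ ∞ := ENNReal.div_ne_top hf.2.ne (by simpa using ht)
  choose! r hr0 hr using fun x (hx : x ∈ A) => hx
  have hball : ∀ x ∈ A, μ (Metric.closedBall x (r x)) ≤
      (∫⁻ y in Metric.closedBall x (r x), ‖f y‖ₑ ∂μ) / ENNReal.ofReal t := fun x hx =>
    measure_closedBall_le_of_lt_average μ hf ht (hr0 x hx) (hr x hx)
  have hv : 0 < μ.real (Metric.ball (0 : E) 1) :=
    ENNReal.toReal_pos (Metric.measure_ball_pos μ 0 one_pos).ne' measure_ball_lt_top.ne
  have hbound : ∀ x ∈ A, r x ≤ max 1 (K.toReal / μ.real (Metric.ball (0 : E) 1)) := by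
    intro x hx
    rcases le_total (r x) 1 with h1 | h1
    · exact le_max_of_le_left h1
    refine le_max_of_le_right ?_
    rw [le_div_iff₀ hv]
    calc r x * μ.real (Metric.ball (0 : E) 1)
        ≤ r x ^ Module.finrank ℝ E * μ.real (Metric.ball (0 : E) 1) := by
          gcongr
          exact le_self_pow₀ h1 Module.finrank_pos.ne'
      _ = μ.real (Metric.closedBall x (r x)) :=
          (μ.addHaar_real_closedBall x (hr0 x hx).le).symm
      _ ≤ K.toReal := ENNReal.toReal_mono hKtop <| (hball x hx).trans <| by
          rw [hK]
          gcongr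
          exact Measure.restrict_le_self
  obtain ⟨s, hsA, hdisj, hcov⟩ :=
    Vitali.exists_disjoint_subfamily_covering_enlargement_closedBall A (fun x => x) r _ hbound 4
      (by norm_num)
  have hcount : s.Countable := hdisj.countable_of_nonempty_interior fun x hx =>
    ⟨x, Metric.ball_subset_interior_closedBall (Metric.mem_ball_self (hr0 x (hsA hx)))⟩
  have hsub : A ⊆ ⋃ b ∈ s, Metric.closedBall b (4 * r b) := by
    intro x hx
    obtain ⟨b, hb, hxb⟩ := hcov x hx
    exact Set.mem_biUnion hb (hxb (Metric.mem_closedBall_self (hr0 x hx).le))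
  calc μ A ≤ μ (⋃ b ∈ s, Metric.closedBall b (4 * r b)) := measure_mono hsub
    _ ≤ ∑' b : s, μ (Metric.closedBall (b : E) (4 * r b)) := measure_biUnion_le μ hcount _
    _ ≤ ∑' b : s, ENNReal.ofReal (4 ^ Module.finrank ℝ E) *
          ((∫⁻ y in Metric.closedBall (b : E) (r b), ‖f y‖ₑ ∂μ) / ENNReal.ofReal t) := by
        refine ENNReal.tsum_le_tsum fun b => ?_
        rw [μ.addHaar_closedBall_mul_of_pos _ (by norm_num : (0 : ℝ) < 4),
          ← μ.addHaar_closedBall_center (b : E)]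
        gcongr
        exact hball b (hsA b.2)
    _ = ENNReal.ofReal (4 ^ Module.finrank ℝ E) *
          ((∫⁻ y in ⋃ b ∈ s, Metric.closedBall b (r b), ‖f y‖ₑ ∂μ) / ENNReal.ofReal t) := by
        rw [ENNReal.tsum_mul_left, lintegral_biUnion hcount
          (fun _ _ => Metric.isClosed_closedBall.measurableSet) hdisj]
        simp only [div_eq_mul_inv, ENNReal.tsum_mul_right]
    _ ≤ ENNReal.ofReal (4 ^ Module.finrank ℝ E) * K := by
        rw [hK]
        gcongr
        exact Measure.restrict_le_self

/-- An integrable function is bounded almost everywhere by any bound for its averages over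
centered balls. -/
lemma ae_norm_le_of_forall_average_le {E F : Type*} [NormedAddCommGroup E] [NormedSpace ℝ E]
    [FiniteDimensional ℝ E] [Nontrivial E] [MeasurableSpace E] [BorelSpace E]
    [NormedAddCommGroup F] (μ : Measure E) [μ.IsAddHaarMeasure] {f : E → F}
    (hf : Integrable f μ) (t : ℝ) :
    ∀ᵐ x ∂μ, (∀ r : ℝ, 0 < r → ⨍ y in Metric.ball x r, ‖f y‖ ∂μ ≤ t) → ‖f x‖ ≤ t := by
  filter_upwards [IsUnifLocDoublingMeasure.ae_tendsto_average μ hf.norm.locallyIntegrable 1]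
    with x hx hle
  refine le_of_tendsto (hx (fun _ : ℝ => x) id tendsto_id ?_) ?_
  · filter_upwards [self_mem_nhdsWithin] with r hr
    exact Metric.mem_closedBall_self (by simpa using le_of_lt hr)
  · filter_upwards [self_mem_nhdsWithin] with r hr
    have hae : Metric.closedBall x r =ᵐ[μ] Metric.ball x r :=
      (ae_eq_of_subset_of_measure_ge Metric.ball_subset_closedBall
        (μ.addHaar_closedBall_eq_addHaar_ball x r).le
        Metric.isOpen_ball.measurableSet.nullMeasurableSet measure_closedBall_lt_top.ne).symm
    simpa only [id, setAverage_congr hae] using hle r hr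

/-- If the averages of `‖u‖` and of `‖w - u‖` over a set are at most `s` and `t`, then those
of `‖w‖` are at most `s + t`. -/
lemma average_norm_le_add {α F : Type*} [MeasurableSpace α] [NormedAddCommGroup F]
    {μ : Measure α} {u w : α → F} (hu : Integrable u μ) (hw : Integrable w μ) {A : Set α}
    {s t : ℝ} (hs : ⨍ y in A, ‖u y‖ ∂μ ≤ s) (ht : ⨍ y in A, ‖w y - u y‖ ∂μ ≤ t) :
    ⨍ y in A, ‖w y‖ ∂μ ≤ s + t := by
  have hwu : Integrable (fun y => ‖w y - u y‖) μ := (hw.sub hu).norm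
  refine le_trans ?_ (add_le_add hs ht)
  simp only [setAverage_eq, smul_eq_mul]
  rw [← mul_add, ← integral_add hu.norm.restrict hwu.restrict]
  refine mul_le_mul_of_nonneg_left ?_ (by positivity)
  refine integral_mono hw.norm.restrict (hu.norm.restrict.add hwu.restrict) fun y => ?_
  simpa using norm_add_le (u y) (w y - u y)

/-- Let `u ∈ L¹(ℝ³; Sym(3))`, `λ, c > 0`, and let
`(w^j) ⊆ L¹` satisfy `‖w^j − u‖_{L¹} ≤ 2^{-j} λ`.  If `(g^j) ⊆ L^∞` satisfy
`‖g^j‖_∞ ≤ cλ` and `g^j = w^j` a.e. on `{Mw^j ≤ 4λ}`, then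
`∫_{{Mu ≤ 2λ}} |g^j − u| dx → 0` as `j → ∞`. -/
theorem truncations_converge_on_good_set
    (u : R3 → M33) (hu : Integrable u) (husym : ∀ x, IsSym3 (u x))
    (lam c : ℝ) (hlam : 0 < lam) (hc : 0 < c)
    (w : ℕ → R3 → M33)
    (hwint : ∀ j, Integrable (w j))
    (hwsym : ∀ j x, IsSym3 (w j x))
    (hwu : ∀ j : ℕ, (∫ x : R3, ‖w j x - u x‖) ≤ lam / 2 ^ j)
    (g : ℕ → R3 → M33)
    (hgmeas : ∀ j, AEStronglyMeasurable (g j) (volume : Measure R3))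
    (hgsym : ∀ j x, IsSym3 (g j x))
    (hgbdd : ∀ j, ∀ᵐ x ∂(volume : Measure R3), ‖g j x‖ ≤ c * lam)
    (hgw : ∀ j, ∀ᵐ x ∂(volume : Measure R3),
      (∀ r : ℝ, 0 < r → (⨍ y in Metric.ball x r, ‖w j y‖) ≤ 4 * lam) →
        g j x = w j x) :
    Tendsto
      (fun j : ℕ =>
        ∫⁻ x in {x : R3 | ∀ r : ℝ, 0 < r →
            (⨍ y in Metric.ball x r, ‖u y‖) ≤ 2 * lam},
          (‖g j x - u x‖₊ : ℝ≥0∞))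
      atTop (nhds 0) := by
  set D : ℕ → ℝ≥0∞ := fun j => ∫⁻ x, ‖w j x - u x‖ₑ with hD
  set B : ℕ → Set R3 := fun j => toMeasurable volume
    {x | ∃ r : ℝ, 0 < r ∧ 2 * lam < ⨍ y in Metric.ball x r, ‖w j y - u y‖} with hB
  set C : ℝ≥0∞ := ENNReal.ofReal ((c + 2) * lam) with hC
  set N : ℝ≥0∞ := ENNReal.ofReal (4 ^ Module.finrank ℝ R3) with hN
  have hDle : ∀ j, D j ≤ ENNReal.ofReal (lam / 2 ^ j) := fun j => by
    refine (ofReal_integral_norm_eq_lintegral_enorm ((hwint j).sub hu)).symm.trans_le ?_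
    exact ENNReal.ofReal_le_ofReal (hwu j)
  have hD0 : Tendsto D atTop (nhds 0) := by
    refine tendsto_of_tendsto_of_tendsto_of_le_of_le tendsto_const_nhds ?_ (fun _ => zero_le) hDle
    have h : Tendsto (fun j : ℕ => lam / 2 ^ j) atTop (nhds 0) :=
      tendsto_const_nhds.div_atTop (tendsto_pow_atTop_atTop_of_one_lt one_lt_two)
    simpa using ENNReal.tendsto_ofReal h
  have hBle : ∀ j, volume (B j) ≤ N * (D j / ENNReal.ofReal (2 * lam)) := fun j => by
    rw [hB, measure_toMeasurable]
    exact measure_exists_lt_average_norm_le volume ((hwint j).sub hu) (by positivity)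
  have hbound : ∀ j, ∫⁻ x in {x : R3 | ∀ r : ℝ, 0 < r →
      (⨍ y in Metric.ball x r, ‖u y‖) ≤ 2 * lam}, (‖g j x - u x‖₊ : ℝ≥0∞) ≤
      D j + C * (N * (D j / ENNReal.ofReal (2 * lam))) := by
    intro j
    have hmeasB : MeasurableSet (B j) := measurableSet_toMeasurable _ _
    have hmeas : AEMeasurable (fun x => ‖w j x - u x‖ₑ) volume := ((hwint j).sub hu).1.enorm
    calc _ ≤ ∫⁻ x in {x : R3 | ∀ r : ℝ, 0 < r →
            (⨍ y in Metric.ball x r, ‖u y‖) ≤ 2 * lam},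
            (‖w j x - u x‖ₑ + (B j).indicator (fun _ => C) x) := by
          refine setLIntegral_mono_ae
            (hmeas.add (measurable_const.indicator hmeasB).aemeasurable).restrict ?_
          filter_upwards [hgbdd j, hgw j, ae_norm_le_of_forall_average_le volume hu (2 * lam)]
            with x hgx hgwx hux hx
          by_cases hxB : x ∈ B j
          · rw [Set.indicator_of_mem hxB]
            refine le_add_left ?_
            rw [← enorm_eq_nnnorm, ← ofReal_norm]
            exact ENNReal.ofReal_le_ofReal (by linarith [norm_sub_le (g j x) (u x), hux hx])
          · rw [Set.indicator_of_notMem hxB, add_zero, ← enorm_eq_nnnorm, hgwx]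
            intro r hr
            have hwx : ⨍ y in Metric.ball x r, ‖w j y - u y‖ ≤ 2 * lam := by
              by_contra! h
              exact hxB (subset_toMeasurable _ _ ⟨r, hr, h⟩)
            linarith [average_norm_le_add hu (hwint j) (hx r hr) hwx]
      _ ≤ ∫⁻ x, (‖w j x - u x‖ₑ + (B j).indicator (fun _ => C) x) := setLIntegral_le_lintegral _ _
      _ = D j + C * volume (B j) := by
          rw [lintegral_add_left' hmeas, lintegral_indicator_const hmeasB]
      _ ≤ _ := by
          gcongr
          exact hBle j
  refine tendsto_of_tendsto_of_tendsto_of_le_of_le tendsto_const_nhds ?_ (fun _ => zero_le) hbound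
  have hlim := hD0.add (ENNReal.Tendsto.const_mul (a := C) (ENNReal.Tendsto.const_mul (a := N)
    (ENNReal.Tendsto.div_const (b := ENNReal.ofReal (2 * lam)) hD0 (Or.inr (by simpa using hlam)))
    (Or.inr ENNReal.ofReal_ne_top)) (Or.inr ENNReal.ofReal_ne_top))
  simpa using hlim
end
end
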